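/- arXiv:2205.09553 — 2 statements merged into one kernel-verified Lean document; each statement's English description precedes it below -/
import Mathlib

section
/- For every rank-2 oriented matroid M on [n], the boundary of the closure of μ^{-1}(M) in Gr(2,ℝ^n) equals the union of μ^{-1}(N) over all oriented matroids N < M in MacP(2,n); equivalently, the closure of μ^{-1}(M) equals the union of μ^{-1}(N) over all N ≤ M. -/
/-- A rank-2 chirotope on `n` elements: a nonzero alternating sign function on pairs
satisfying the rank-2 Grassmann–Plücker relations.  A rank-2 oriented matroid is such a
chirotope up to global sign. -/
structure Chirotope2 (n : ℕ) : Type where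
  χ : Fin n → Fin n → SignType
  nonzero : ∃ i j, χ i j ≠ 0
  alt : ∀ i j, χ i j = - χ j i
  gp : ∀ x y0 y1 y2 : Fin n,
    (χ y0 x * χ y1 y2 = 0 ∧ χ y1 x * χ y0 y2 = 0 ∧ χ y2 x * χ y0 y1 = 0) ∨
    ((χ y0 x * χ y1 y2 = 1 ∨ -(χ y1 x * χ y0 y2) = 1 ∨ χ y2 x * χ y0 y1 = 1) ∧
     (χ y0 x * χ y1 y2 = -1 ∨ -(χ y1 x * χ y0 y2) = -1 ∨ χ y2 x * χ y0 y1 = -1))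

/-- The weak map order on rank-2 oriented matroids: `N ≤ M` iff, for a suitable global sign,
every basis of `N` is a basis of `M` with matching orientation. -/
def omLe {n : ℕ} (N M : Chirotope2 n) : Prop :=
  ∃ ε : SignType, (ε = 1 ∨ ε = -1) ∧ ∀ i j, N.χ i j = 0 ∨ N.χ i j = ε * M.χ i j

/-- Strict weak map order. -/
def omLt {n : ℕ} (N M : Chirotope2 n) : Prop := omLe N M ∧ ¬ omLe M N

/-- Two chirotopes determine the same oriented matroid. -/
def omEquiv {n : ℕ} (N M : Chirotope2 n) : Prop := omLe N M ∧ omLe M N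

/-- `M` covers `N` in the weak map order: `N < M` and nothing lies strictly between. -/
def OMCovers {n : ℕ} (N M : Chirotope2 n) : Prop :=
  omLt N M ∧ ∀ N' : Chirotope2 n, omLt N N' → ¬ omLt N' M

/-- `i` is a loop of `M`. -/
def IsLoop {n : ℕ} (M : Chirotope2 n) (i : Fin n) : Prop := ∀ k, M.χ i k = 0

/-- The parallel/anti-parallel class of `i` in `M`. -/
def ParClass {n : ℕ} (M : Chirotope2 n) (i : Fin n) : Set (Fin n) :=
  {j | (∀ k, M.χ j k = M.χ i k) ∨ (∀ k, M.χ j k = - M.χ i k)}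

/-- Two full-rank `2 × n` matrices are equivalent iff they have the same row space. -/
def grSetoid (n : ℕ) : Setoid {A : Matrix (Fin 2) (Fin n) ℝ // A.rank = 2} where
  r A B := LinearMap.range (Matrix.vecMulLinear (A : Matrix (Fin 2) (Fin n) ℝ)) =
           LinearMap.range (Matrix.vecMulLinear (B : Matrix (Fin 2) (Fin n) ℝ))
  iseqv := ⟨fun _ => rfl, Eq.symm, Eq.trans⟩

/-- The Grassmannian `Gr(2, ℝⁿ)` of 2-dimensional subspaces of `ℝⁿ`, as the quotient of the
space of full-rank `2 × n` real matrices by row equivalence, with the quotient topology. -/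
abbrev Gr2 (n : ℕ) := Quotient (grSetoid n)

/-- The chirotope of a `2 × n` matrix: `χ(i,j)` is the sign of the determinant of the
`2 × 2` submatrix with columns `i, j`. -/
noncomputable def chiMat {n : ℕ} (A : Matrix (Fin 2) (Fin n) ℝ) (i j : Fin n) : SignType :=
  SignType.sign (A 0 i * A 1 j - A 0 j * A 1 i)

/-- The fiber `μ⁻¹(M) ⊆ Gr(2, ℝⁿ)` of a rank-2 oriented matroid `M` under the map `μ`
sending a 2-plane to the oriented matroid it determines (a chirotope up to global sign). -/
noncomputable def muFiber {n : ℕ} (M : Chirotope2 n) : Set (Gr2 n) :=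
  {x | ∃ A : {A : Matrix (Fin 2) (Fin n) ℝ // A.rank = 2},
        x = Quotient.mk (grSetoid n) A ∧
        ((∀ i j, chiMat (A : Matrix (Fin 2) (Fin n) ℝ) i j = M.χ i j) ∨
         (∀ i j, chiMat (A : Matrix (Fin 2) (Fin n) ℝ) i j = - M.χ i j))}

/-- The `2 × 2` minor. -/
def dt {n : ℕ} (A : Matrix (Fin 2) (Fin n) ℝ) (i j : Fin n) : ℝ :=
  A 0 i * A 1 j - A 0 j * A 1 i

/-- Inner product of columns. -/
def ip {n : ℕ} (A : Matrix (Fin 2) (Fin n) ℝ) (i j : Fin n) : ℝ :=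
  A 0 i * A 0 j + A 1 i * A 1 j

lemma chiMat_eq {n : ℕ} (A : Matrix (Fin 2) (Fin n) ℝ) (i j : Fin n) :
    chiMat A i j = SignType.sign (dt A i j) := rfl

lemma rank_two_iff {n : ℕ} (A : Matrix (Fin 2) (Fin n) ℝ) :
    A.rank = 2 ↔ ∃ i j, dt A i j ≠ 0 := by
  have key : A.rank = 2 ↔ LinearIndependent ℝ A.row := by
    rw [linearIndependent_iff_card_eq_finrank_span, Matrix.rank_eq_finrank_span_row]
    simp [Set.finrank, eq_comm]
  have hrow : A.row = ![A 0, A 1] := by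
    ext r i; fin_cases r <;> rfl
  rw [key, hrow, LinearIndependent.pair_iff]
  constructor
  · intro h
    by_contra hcon
    push Not at hcon
    have hz : ∀ i, A 0 i = 0 := by
      intro i
      have := h (A 1 i) (- A 0 i) (by
        ext j
        have := hcon j i
        unfold dt at this
        simp only [Pi.add_apply, Pi.smul_apply, smul_eq_mul, Pi.zero_apply]
        linarith)
      simpa using this.2
    have := h 1 0 (by ext j; simp [hz j])
    simp at this
  · rintro ⟨i, j, hij⟩ a b hab
    have e1 := congrFun hab i
    have e2 := congrFun hab j
    simp only [Pi.add_apply, Pi.smul_apply, smul_eq_mul, Pi.zero_apply] at e1 e2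
    have ha : a * dt A i j = 0 := by unfold dt; linear_combination A 1 j * e1 - A 1 i * e2
    have hb : b * dt A i j = 0 := by unfold dt; linear_combination A 0 i * e2 - A 0 j * e1
    exact ⟨(mul_eq_zero.1 ha).resolve_right hij, (mul_eq_zero.1 hb).resolve_right hij⟩

lemma sign_gp (a b c : ℝ) (h : a - b + c = 0) :
    (SignType.sign a = 0 ∧ SignType.sign b = 0 ∧ SignType.sign c = 0) ∨
    ((SignType.sign a = 1 ∨ -(SignType.sign b) = 1 ∨ SignType.sign c = 1) ∧
     (SignType.sign a = -1 ∨ -(SignType.sign b) = -1 ∨ SignType.sign c = -1)) := by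
  rcases lt_trichotomy a 0 with ha | ha | ha <;> rcases lt_trichotomy b 0 with hb | hb | hb <;>
    rcases lt_trichotomy c 0 with hc | hc | hc <;>
    first
    | (exfalso; linarith)
    | simp [ha, hb, hc]

/-- The oriented matroid of a full-rank matrix. -/
noncomputable def omOf {n : ℕ} (A : Matrix (Fin 2) (Fin n) ℝ) (hA : A.rank = 2) :
    Chirotope2 n where
  χ := chiMat A
  nonzero := by
    obtain ⟨i, j, h⟩ := (rank_two_iff A).1 hA
    exact ⟨i, j, by simpa [chiMat_eq] using h⟩
  alt i j := by
    rw [chiMat_eq, chiMat_eq, ← Left.sign_neg]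
    congr 1; unfold dt; ring
  gp x y0 y1 y2 := by
    simp only [chiMat_eq, ← sign_mul]
    apply sign_gp
    unfold dt; ring

/-- Global sign change. -/
def negOM {n : ℕ} (M : Chirotope2 n) : Chirotope2 n where
  χ i j := - M.χ i j
  nonzero := by
    obtain ⟨i, j, h⟩ := M.nonzero
    exact ⟨i, j, by revert h; generalize M.χ i j = a; decide +revert⟩
  alt i j := by rw [M.alt i j]
  gp x y0 y1 y2 := by simpa using M.gp x y0 y1 y2

lemma chi_of_rel {n : ℕ} (A B : {A : Matrix (Fin 2) (Fin n) ℝ // A.rank = 2})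
    (h : (grSetoid n).r A B) :
    (∀ i j, chiMat A.1 i j = chiMat B.1 i j) ∨ (∀ i j, chiMat A.1 i j = - chiMat B.1 i j) := by
  have h' : LinearMap.range (Matrix.vecMulLinear A.1) =
           LinearMap.range (Matrix.vecMulLinear B.1) := h
  have hr : ∀ r : Fin 2, ∃ g : Fin 2 → ℝ, ∀ i, A.1 r i = g 0 * B.1 0 i + g 1 * B.1 1 i := by
    intro r
    have : A.1 r ∈ LinearMap.range (Matrix.vecMulLinear B.1) := by
      rw [← h']
      refine ⟨Pi.single r 1, ?_⟩
      simp
      rfl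
    obtain ⟨g, hg⟩ := this
    refine ⟨g, fun i => ?_⟩
    rw [← hg]
    simp [Matrix.vecMul, dotProduct, Fin.sum_univ_two]
  obtain ⟨g, hg⟩ := hr 0
  obtain ⟨k, hk⟩ := hr 1
  have hd : ∀ i j, dt A.1 i j = (g 0 * k 1 - g 1 * k 0) * dt B.1 i j := by
    intro i j
    unfold dt
    rw [hg, hg, hk, hk]; ring
  obtain ⟨i, j, hij⟩ := (rank_two_iff A.1).1 A.2
  have hne : g 0 * k 1 - g 1 * k 0 ≠ 0 := by
    intro h0; apply hij; rw [hd, h0, zero_mul]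
  rcases lt_or_gt_of_ne hne with h0 | h0
  · right; intro i j
    rw [chiMat_eq, chiMat_eq, hd, sign_mul, sign_neg h0]; simp
  · left; intro i j
    rw [chiMat_eq, chiMat_eq, hd, sign_mul, sign_pos h0]; simp

/-- Ranking a total preorder given by signs. -/
lemma rankSum {ι : Type*} (I : Finset ι) (T : ι → ι → SignType)
    (anti : ∀ i ∈ I, ∀ j ∈ I, T i j = - T j i)
    (tr : ∀ i ∈ I, ∀ j ∈ I, ∀ k ∈ I, 0 ≤ T i j → T k i ≤ T k j) :
    ∀ i ∈ I, ∀ j ∈ I,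
      SignType.sign ((∑ k ∈ I, (T k j : ℝ)) - ∑ k ∈ I, (T k i : ℝ)) = T i j := by
  have cm : ∀ a b : SignType, a ≤ b → (a : ℝ) ≤ (b : ℝ) := by
    intro a b; cases a <;> cases b <;> simp
  have cs : ∀ a b : SignType, a < b → (a : ℝ) < (b : ℝ) := by
    intro a b; cases a <;> cases b <;> simp
  have le : ∀ i ∈ I, ∀ j ∈ I, 0 ≤ T i j → (∑ k ∈ I, (T k i : ℝ)) ≤ ∑ k ∈ I, (T k j : ℝ) :=
    fun i hi j hj h => Finset.sum_le_sum fun k hk => cm _ _ (tr i hi j hj k hk h)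
  have lt : ∀ i ∈ I, ∀ j ∈ I, T i j = 1 → (∑ k ∈ I, (T k i : ℝ)) < ∑ k ∈ I, (T k j : ℝ) := by
    intro i hi j hj h
    refine Finset.sum_lt_sum
      (fun k hk => cm _ _ (tr i hi j hj k hk (by rw [h]; decide))) ⟨i, hi, cs _ _ ?_⟩
    have := anti i hi i hi
    rw [h]; revert this; generalize T i i = a; decide +revert
  intro i hi j hj
  have ha := anti j hj i hi
  rcases h : T i j with _ | _ | _
  · have h : T i j = 0 := h
    have h1 := le i hi j hj (by rw [h])
    have h2 := le j hj i hi (by rw [ha, h]; decide)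
    rw [le_antisymm h1 h2, sub_self, sign_zero]; rfl
  · have h : T i j = -1 := h
    have h2 := lt j hj i hi (by rw [ha, h]; decide)
    rw [sign_neg (by linarith)]; rfl
  · have h : T i j = 1 := h
    have h2 := lt i hi j hj h
    rw [sign_pos (by linarith)]; rfl

/-- Transitivity from the Grassmann–Plücker relations. -/
lemma gp_trans {n : ℕ} (M : Chirotope2 n) (c i j k : Fin n)
    (hi : M.χ i c ≠ 0) (hj : M.χ j c ≠ 0) (hk : M.χ k c ≠ 0)
    (h : 0 ≤ M.χ i c * M.χ j c * M.χ i j) :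
    M.χ k c * M.χ i c * M.χ k i ≤ M.χ k c * M.χ j c * M.χ k j := by
  have g := M.gp c k i j
  revert hi hj hk h g
  generalize M.χ i c = a
  generalize M.χ j c = b
  generalize M.χ k c = d
  generalize M.χ i j = e
  generalize M.χ k i = f
  generalize M.χ k j = g
  revert a b d e f g
  decide

/-- One-element extension. -/
lemma extend_one {n : ℕ} (M : Chirotope2 n) (C : Matrix (Fin 2) (Fin n) ℝ) (S : Finset (Fin n))
    (hC : ∀ i ∈ S, ∀ j ∈ S, chiMat C i j = M.χ i j)
    (hS : ∃ p ∈ S, ∃ q ∈ S, M.χ p q ≠ 0) (i : Fin n) :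
    ∃ x y : ℝ, ∀ j ∈ S, SignType.sign (x * C 1 j - C 0 j * y) = M.χ i j := by
  by_cases hcase : ∃ j ∈ S, ∃ k ∈ S, M.χ i j = 0 ∧ M.χ j k ≠ 0
  · obtain ⟨j, hj, k, hk, h0, h1⟩ := hcase
    refine ⟨((M.χ i k * M.χ j k : SignType) : ℝ) * C 0 j,
      ((M.χ i k * M.χ j k : SignType) : ℝ) * C 1 j, fun l hl => ?_⟩
    have e : ((M.χ i k * M.χ j k : SignType) : ℝ) * C 0 j * C 1 l
        - C 0 l * (((M.χ i k * M.χ j k : SignType) : ℝ) * C 1 j)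
        = ((M.χ i k * M.χ j k : SignType) : ℝ) * dt C j l := by unfold dt; ring
    have s : ∀ a : SignType, SignType.sign (a : ℝ) = a := by intro a; cases a <;> simp
    rw [e, sign_mul, s, ← chiMat_eq, hC j hj l hl]
    have g := M.gp l i j k
    revert h0 h1 g
    generalize M.χ i j = a
    generalize M.χ j k = b
    generalize M.χ i k = d
    generalize M.χ j l = e
    generalize M.χ i l = f
    generalize M.χ k l = g
    revert a b d e f g
    decide
  · push Not at hcase
    set I := S.filter (fun j => M.χ i j ≠ 0) with hI
    have mem : ∀ j, j ∈ I ↔ j ∈ S ∧ M.χ i j ≠ 0 := by intro j; simp [hI]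
    have alt0 : ∀ j, M.χ i j ≠ 0 → M.χ j i ≠ 0 := by
      intro j h; rw [M.alt j i]; revert h; generalize M.χ i j = a; decide +revert
    set T : Fin n → Fin n → SignType := fun j k => M.χ j i * M.χ k i * M.χ j k with hT
    have R := rankSum I T
      (by
        intro j _ k _
        simp only [hT]
        rw [M.alt j k]
        generalize M.χ j i = a
        generalize M.χ k i = b
        generalize M.χ k j = c
        decide +revert)
      (by
        intro j hj k hk l hl h
        exact gp_trans M i j k l (alt0 _ ((mem _).1 hj).2) (alt0 _ ((mem _).1 hk).2)
          (alt0 _ ((mem _).1 hl).2) h)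
    obtain ⟨p, hp, q, hq, hpq⟩ := hS
    have hpI : p ∈ I := (mem p).2 ⟨hp, fun h => hpq (hcase p hp q hq h)⟩
    have hqI : q ∈ I := (mem q).2 ⟨hq, fun h => hpq (by
      rw [M.alt, hcase q hq p hp h]; rfl)⟩
    set s : Fin n → ℝ := fun j => ∑ k ∈ I, (T k j : ℝ) with hs
    obtain ⟨a, haI, ha⟩ := I.exists_min_image s ⟨p, hpI⟩
    obtain ⟨b, hbI, hb⟩ := I.exists_max_image s ⟨p, hpI⟩
    have hab : s a < s b := by
      by_contra hcon
      have h1 := ha p hpI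
      have h2 := hb p hpI
      have h3 := ha q hqI
      have h4 := hb q hqI
      have : s q - s p = 0 := by linarith
      have h5 := R p hpI q hqI
      change SignType.sign (s q - s p) = _ at h5
      rw [this, sign_zero] at h5
      have h6 := alt0 _ ((mem p).1 hpI).2
      have h7 := alt0 _ ((mem q).1 hqI).2
      revert h5 h6 h7 hpq
      simp only [hT]
      generalize M.χ p i = a
      generalize M.χ q i = b
      generalize M.χ p q = c
      decide +revert
    have haS := ((mem a).1 haI).1
    have hbS := ((mem b).1 hbI).1
    refine ⟨(M.χ b i : ℝ) * C 0 b - (M.χ a i : ℝ) * C 0 a,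
      (M.χ b i : ℝ) * C 1 b - (M.χ a i : ℝ) * C 1 a, fun j hj => ?_⟩
    have e : ((M.χ b i : ℝ) * C 0 b
          - (M.χ a i : ℝ) * C 0 a) * C 1 j
        - C 0 j * ((M.χ b i : ℝ) * C 1 b - (M.χ a i : ℝ) * C 1 a)
        = - ((M.χ a i : ℝ) * dt C a j + (M.χ b i : ℝ) * dt C j b) := by unfold dt; ring
    rw [e]
    have d1 : SignType.sign (dt C a j) = M.χ a j := hC a haS j hj
    have d2 : SignType.sign (dt C j b) = M.χ j b := hC j hj b hbS
    by_cases hji : M.χ i j = 0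
    · have z1 : M.χ a j = 0 := by rw [M.alt, hcase j hj a haS hji]; rfl
      have z2 : M.χ j b = 0 := hcase j hj b hbS hji
      rw [z1, sign_eq_zero_iff] at d1
      rw [z2, sign_eq_zero_iff] at d2
      rw [d1, d2, hji]; simp
    · have hjI : j ∈ I := (mem j).2 ⟨hj, hji⟩
      have sg : ∀ a : SignType, SignType.sign (a : ℝ) = a := by intro a; cases a <;> simp
      have t1 : SignType.sign ((M.χ j i : ℝ) * ((M.χ a i : ℝ) * dt C a j))
          = SignType.sign (s j - s a) := by
        have := R a haI j hjI
        change SignType.sign (s j - s a) = _ at this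
        rw [this, sign_mul, sign_mul, sg, sg, d1]
        simp only [hT]
        generalize M.χ j i = x
        generalize M.χ a i = y
        generalize M.χ a j = z
        clear * -
        decide +revert
      have t2 : SignType.sign ((M.χ j i : ℝ) * ((M.χ b i : ℝ) * dt C j b))
          = SignType.sign (s b - s j) := by
        have := R j hjI b hbI
        change SignType.sign (s b - s j) = _ at this
        rw [this, sign_mul, sign_mul, sg, sg, d2]
        simp only [hT]
        generalize M.χ j i = x
        generalize M.χ b i = y
        generalize M.χ j b = z
        clear * -
        decide +revert
      have k1 := ha j hjI
      have k2 := hb j hjI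
      have nn : ∀ x y : ℝ, SignType.sign x = SignType.sign y → 0 ≤ y → 0 ≤ x := by
        intro x y h hy
        rcases hy.eq_or_lt with h0 | h0
        · rw [← h0, sign_zero, sign_eq_zero_iff] at h; exact h.ge
        · rw [sign_pos h0, sign_eq_one_iff] at h; exact h.le
      have pp : ∀ x y : ℝ, SignType.sign x = SignType.sign y → 0 < y → 0 < x := by
        intro x y h h0
        rw [sign_pos h0, sign_eq_one_iff] at h; exact h
      have n1 := nn _ _ t1 (by linarith)
      have n2 := nn _ _ t2 (by linarith)
      have tot : 0 < (M.χ j i : ℝ) * ((M.χ a i : ℝ) * dt C a j + (M.χ b i : ℝ) * dt C j b) := by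
        rw [mul_add]
        by_cases hlt : s a < s j
        · have := pp _ _ t1 (by linarith)
          linarith
        · have := pp _ _ t2 (by linarith)
          linarith
      have := sign_pos tot
      rw [sign_mul, sg] at this
      rw [Left.sign_neg, M.alt i j]
      revert this
      generalize SignType.sign ((M.χ a i : ℝ) * dt C a j + (M.χ b i : ℝ) * dt C j b) = y
      generalize M.χ j i = x
      clear * -
      decide +revert

lemma extend_all {n : ℕ} (M : Chirotope2 n) (C : Matrix (Fin 2) (Fin n) ℝ) (S : Finset (Fin n))
    (hC : ∀ i ∈ S, ∀ j ∈ S, chiMat C i j = M.χ i j)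
    (hS : ∃ p ∈ S, ∃ q ∈ S, M.χ p q ≠ 0) (U : Finset (Fin n)) :
    ∃ D : Matrix (Fin 2) (Fin n) ℝ, (∀ r, ∀ i ∈ S, D r i = C r i) ∧
      ∀ i ∈ S ∪ U, ∀ j ∈ S ∪ U, chiMat D i j = M.χ i j := by
  induction U using Finset.induction_on with
  | empty => exact ⟨C, fun _ _ _ => rfl, by simpa using hC⟩
  | insert a U ha ih =>
    obtain ⟨D, hD1, hD2⟩ := ih
    by_cases haS : a ∈ S ∪ U
    · refine ⟨D, hD1, ?_⟩
      rw [Finset.union_insert, Finset.insert_eq_of_mem haS]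
      exact hD2
    obtain ⟨p, hp, q, hq, hpq⟩ := hS
    obtain ⟨x, y, hxy⟩ := extend_one M D (S ∪ U) hD2
      ⟨p, Finset.mem_union_left _ hp, q, Finset.mem_union_left _ hq, hpq⟩ a
    have zz : M.χ a a = 0 := by
      have := M.alt a a
      revert this; generalize M.χ a a = z; decide +revert
    refine ⟨Matrix.of fun r k => if k = a then ![x, y] r else D r k, ?_, ?_⟩
    · intro r i hi
      have : i ≠ a := by rintro rfl; exact haS (Finset.mem_union_left _ hi)
      simp [this, hD1 r i hi]
    · rw [Finset.union_insert]
      intro i hi j hj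
      rw [Finset.mem_insert] at hi hj
      by_cases hia : i = a
      · subst hia
        by_cases hja : j = i
        · subst hja
          rw [zz]; simp [chiMat]
        · rw [← hxy j (hj.resolve_left hja)]
          simp [chiMat, hja]
      · by_cases hja : j = a
        · subst hja
          rw [M.alt, ← hxy i (hi.resolve_left hia), ← Left.sign_neg]
          simp [chiMat, hia]
        · rw [← hD2 i (hi.resolve_left hia) j (hj.resolve_left hja)]
          simp [chiMat, hia, hja]

open Filter Topology in
/-- Shrinking the loops. -/
lemma mem_closure_of_partial {n : ℕ} (M : Chirotope2 n) (C : Matrix (Fin 2) (Fin n) ℝ)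
    (S : Finset (Fin n)) (hC : ∀ i ∈ S, ∀ j ∈ S, chiMat C i j = M.χ i j)
    (hS : ∃ p ∈ S, ∃ q ∈ S, M.χ p q ≠ 0) (h0 : ∀ i ∉ S, ∀ r, C r i = 0) :
    C ∈ closure {D : Matrix (Fin 2) (Fin n) ℝ | ∀ i j, chiMat D i j = M.χ i j} := by
  obtain ⟨D, hD1, hD2⟩ := extend_all M C S hC hS Finset.univ
  simp only [Finset.mem_union, Finset.mem_univ, or_true, forall_true_left] at hD2
  let F : ℝ → Matrix (Fin 2) (Fin n) ℝ := fun t =>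
    Matrix.of fun r i => (if i ∈ S then 1 else t) * D r i
  have hF : Continuous F := by
    refine continuous_matrix fun r i => ?_
    by_cases hi : i ∈ S
    · simp only [F, hi, Matrix.of_apply, if_true]
      fun_prop
    · simp only [F, hi, Matrix.of_apply, if_false]
      fun_prop
  have hF0 : F 0 = C := by
    ext r i
    by_cases hi : i ∈ S
    · simp [F, hi, hD1 r i hi]
    · simp [F, hi, h0 i hi r]
  have ht : Tendsto F (𝓝[>] 0) (𝓝 C) := by
    rw [← hF0]; exact (hF.tendsto 0).mono_left nhdsWithin_le_nhds
  refine mem_closure_of_tendsto ht ?_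
  filter_upwards [self_mem_nhdsWithin] with t ht i j
  have ht : 0 < t := ht
  rw [← hD2 i j, chiMat_eq, chiMat_eq]
  have : dt (F t) i j = ((if i ∈ S then 1 else t) * (if j ∈ S then 1 else t)) * dt D i j := by
    simp only [dt, F, Matrix.of_apply]; ring
  rw [this, sign_mul, sign_pos, one_mul]
  split_ifs <;> positivity

open Filter Topology in
lemma mem_closure_main {n : ℕ} (M : Chirotope2 n) (A : Matrix (Fin 2) (Fin n) ℝ)
    (hA : A.rank = 2) (h : ∀ i j, chiMat A i j = 0 ∨ chiMat A i j = M.χ i j) :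
    A ∈ closure {D : Matrix (Fin 2) (Fin n) ℝ | ∀ i j, chiMat D i j = M.χ i j} := by
  classical
  obtain ⟨p, q, hpq⟩ := (rank_two_iff A).1 hA
  have hM : ∀ i j, dt A i j ≠ 0 → SignType.sign (dt A i j) = M.χ i j := by
    intro i j hij
    rcases h i j with h | h
    · exact absurd (sign_eq_zero_iff.1 h) hij
    · exact h
  -- nonloops
  set S : Finset (Fin n) := Finset.univ.filter fun i => ip A i i ≠ 0 with hSdef
  have memS : ∀ i, i ∈ S ↔ ip A i i ≠ 0 := by intro i; simp [hSdef]
  have ippos : ∀ i, ip A i i ≠ 0 → 0 < ip A i i := by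
    intro i hi
    refine lt_of_le_of_ne ?_ hi.symm
    unfold ip; nlinarith [sq_nonneg (A 0 i), sq_nonneg (A 1 i)]
  have ip0 : ∀ i, ip A i i = 0 → A 0 i = 0 ∧ A 1 i = 0 := by
    intro i hi
    unfold ip at hi
    constructor <;> nlinarith [mul_self_nonneg (A 0 i), mul_self_nonneg (A 1 i)]
  have hnl : ∀ i c, dt A i c ≠ 0 → ip A i i ≠ 0 := by
    intro i c hic h0
    obtain ⟨h1, h2⟩ := ip0 i h0
    apply hic; unfold dt; rw [h1, h2]; ring
  have dtalt : ∀ i j, dt A i j = - dt A j i := by intro i j; unfold dt; ring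
  have hex : ∀ i, ip A i i ≠ 0 → ∃ c, dt A i c ≠ 0 := by
    intro i hi
    by_contra hcon
    push Not at hcon
    have e : ip A i i * dt A p q = 0 := by
      have e1 := hcon p
      have e2 := hcon q
      have : ip A i i * dt A p q = ip A i p * dt A i q - ip A i q * dt A i p := by
        unfold ip dt; ring
      rw [this, e1, e2]; ring
    rcases mul_eq_zero.1 e with e | e
    · exact hi e
    · exact hpq e
  have dtrans : ∀ i j k, ip A i i ≠ 0 → dt A i j = 0 → dt A i k = 0 → dt A j k = 0 := by
    intro i j k hi h1 h2
    have : ip A i i * dt A j k = ip A i j * dt A i k - ip A i k * dt A i j := by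
      unfold ip dt; ring
    rw [h1, h2] at this
    simpa [hi] using this
  have ipsign : ∀ i k c, ip A i i ≠ 0 → dt A i k = 0 → dt A i c ≠ 0 →
      SignType.sign (ip A i k) = SignType.sign (dt A i c) * SignType.sign (dt A k c) := by
    intro i k c hi h1 h2
    have e : ip A i i * dt A k c = ip A i k * dt A i c - dt A i k * ip A i c := by
      unfold ip dt; ring
    rw [h1, zero_mul, sub_zero] at e
    have e' := congrArg SignType.sign e
    rw [sign_mul, sign_mul, sign_pos (ippos i hi), one_mul] at e'
    have h3 : SignType.sign (dt A i c) ≠ 0 := by simpa using h2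
    rw [e']
    revert h3
    generalize SignType.sign (dt A i c) = a
    generalize SignType.sign (ip A i k) = b
    decide +revert
  let T : Fin n → Fin n → SignType := fun k i => SignType.sign (ip A k i) * M.χ k i
  let I : Fin n → Finset (Fin n) := fun i => Finset.univ.filter fun k => ip A k k ≠ 0 ∧ dt A i k = 0
  have memI : ∀ i k, k ∈ I i ↔ ip A k k ≠ 0 ∧ dt A i k = 0 := by intro i k; simp [I]
  let s : Fin n → ℝ := fun i => ∑ k ∈ I i, (T k i : ℝ)
  have hs : ∀ i j, ip A i i ≠ 0 → ip A j j ≠ 0 → dt A i j = 0 →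
      SignType.sign (s j - s i) = T i j := by
    intro i j hi hj hij
    have hji : dt A j i = 0 := by rw [dtalt, hij, neg_zero]
    have hII : I j = I i := by
      ext k
      rw [memI, memI]
      constructor
      · rintro ⟨h1, h2⟩; exact ⟨h1, dtrans j i k hj hji h2⟩
      · rintro ⟨h1, h2⟩; exact ⟨h1, dtrans i j k hi hij h2⟩
    obtain ⟨c, hc⟩ := hex i hi
    have hcI : ∀ k ∈ I i, dt A k c ≠ 0 := by
      intro k hk h0
      obtain ⟨h1, h2⟩ := (memI i k).1 hk
      exact hc (dtrans k i c h1 (by rw [dtalt, h2, neg_zero]) h0)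
    have hcM : ∀ k ∈ I i, M.χ k c ≠ 0 := by
      intro k hk
      rw [← hM k c (hcI k hk)]
      simpa using hcI k hk
    have hT : ∀ k ∈ I i, ∀ l ∈ I i, T k l = M.χ k c * M.χ l c * M.χ k l := by
      intro k hk l hl
      obtain ⟨h1, h2⟩ := (memI i k).1 hk
      obtain ⟨h3, h4⟩ := (memI i l).1 hl
      change SignType.sign (ip A k l) * M.χ k l = _
      rw [ipsign k l c h1 (dtrans i k l hi h2 h4) (hcI k hk), hM k c (hcI k hk), hM l c (hcI l hl)]
    have R := rankSum (I i) T
      (by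
        intro j hj k hk
        rw [hT j hj k hk, hT k hk j hj, M.alt j k]
        generalize M.χ j c = a
        generalize M.χ k c = b
        generalize M.χ k j = d
        decide +revert)
      (by
        intro j hj k hk l hl h
        rw [hT j hj k hk] at h
        rw [hT l hl j hj, hT l hl k hk]
        exact gp_trans M c j k l (hcM j hj) (hcM k hk) (hcM l hl) h)
      i ((memI i i).2 ⟨hi, by unfold dt; ring⟩) j ((memI i j).2 ⟨hj, hij⟩)
    simp only [s]
    rw [hII]; exact R
  let F : ℝ → Matrix (Fin 2) (Fin n) ℝ := fun t =>
    Matrix.of fun r i => A r i + t * s i * (![- A 1 i, A 0 i] r)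
  have hF : Continuous F := by
    refine continuous_matrix fun r i => ?_
    simp only [F, Matrix.of_apply]
    fun_prop
  have hF0 : F 0 = A := by
    ext r i; simp [F]
  have ht : Tendsto F (𝓝[>] 0) (𝓝 A) := by
    have := (hF.tendsto 0).mono_left (nhdsWithin_le_nhds (s := Set.Ioi (0:ℝ)))
    rwa [hF0] at this
  have hdt : ∀ t i j, dt (F t) i j
      = dt A i j * (1 + t * t * (s i * s j)) + t * ((s j - s i) * ip A i j) := by
    intro t i j
    simp [F, dt, ip]; ring
  have hev : ∀ i j, ∀ᶠ t in 𝓝[>] (0:ℝ), dt A i j ≠ 0 →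
      SignType.sign (dt (F t) i j) = SignType.sign (dt A i j) := by
    intro i j
    have hc : Tendsto (fun t => dt (F t) i j) (𝓝[>] (0:ℝ)) (𝓝 (dt A i j)) := by
      have h1 : Continuous fun t => dt (F t) i j := by
        simp only [hdt]; fun_prop
      have := (h1.tendsto 0).mono_left (nhdsWithin_le_nhds (s := Set.Ioi (0:ℝ)))
      simpa [hF0] using this
    rcases lt_trichotomy (dt A i j) 0 with h0 | h0 | h0
    · filter_upwards [hc.eventually_lt_const h0] with t ht _
      rw [sign_neg ht, sign_neg h0]
    · exact Eventually.of_forall fun t hh => absurd h0 hh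
    · filter_upwards [hc.eventually_const_lt h0] with t ht _
      rw [sign_pos ht, sign_pos h0]
  have hev' := eventually_all.2 fun i => eventually_all.2 (hev i)
  rw [← closure_closure]
  refine mem_closure_of_tendsto ht ?_
  filter_upwards [hev', self_mem_nhdsWithin] with t h1 ht0
  have ht0 : 0 < t := ht0
  refine mem_closure_of_partial M (F t) S ?_ ?_ ?_
  · intro i hi j hj
    rw [memS] at hi hj
    by_cases h0 : dt A i j = 0
    · rw [chiMat_eq, hdt, h0, zero_mul, zero_add, sign_mul, sign_mul, sign_pos ht0, one_mul,
        hs i j hi hj h0]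
      obtain ⟨c, hc⟩ := hex i hi
      have hjc : dt A j c ≠ 0 := fun h' => hc (dtrans j i c hj (by rw [dtalt, h0, neg_zero]) h')
      have e := ipsign i j c hi h0 hc
      have e1 : SignType.sign (dt A i c) ≠ 0 := by simpa using hc
      have e2 : SignType.sign (dt A j c) ≠ 0 := by simpa using hjc
      simp only [T]
      revert e e1 e2
      generalize SignType.sign (dt A i c) = a
      generalize SignType.sign (dt A j c) = b
      generalize SignType.sign (ip A i j) = d
      generalize M.χ i j = e
      decide +revert
    · rw [chiMat_eq, h1 i j h0, hM i j h0]
  · refine ⟨p, (memS p).2 (hnl p q hpq), q, (memS q).2 (hnl q p ?_), ?_⟩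
    · rw [dtalt]; simpa using hpq
    · rw [← hM p q hpq]; simpa using hpq
  · intro i hi r
    rw [memS, not_not] at hi
    obtain ⟨h2, h3⟩ := ip0 i hi
    fin_cases r <;> simp [F, h2, h3]

lemma mk_mem_closure {n : ℕ} (M : Chirotope2 n) (A : {A : Matrix (Fin 2) (Fin n) ℝ // A.rank = 2})
    (h : ∀ i j, chiMat A.1 i j = 0 ∨ chiMat A.1 i j = M.χ i j) :
    Quotient.mk (grSetoid n) A ∈
      closure (Quotient.mk (grSetoid n) '' {B | ∀ i j, chiMat B.1 i j = M.χ i j}) := by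
  have hcont : Continuous (Quotient.mk (grSetoid n)) := continuous_quotient_mk'
  apply image_closure_subset_closure_image hcont
  refine ⟨A, ?_, rfl⟩
  rw [closure_subtype]
  refine closure_mono ?_ (mem_closure_main M A.1 A.2 h)
  intro D hD
  refine ⟨⟨D, ?_⟩, hD, rfl⟩
  rw [rank_two_iff]
  obtain ⟨i, j, hij⟩ := M.nonzero
  refine ⟨i, j, fun h0 => hij ?_⟩
  rw [← hD i j, chiMat_eq, h0, sign_zero]

lemma muFiber_congr {n : ℕ} (M : Chirotope2 n) (A : {A : Matrix (Fin 2) (Fin n) ℝ // A.rank = 2}) :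
    Quotient.mk (grSetoid n) A ∈ muFiber M ↔
      ((∀ i j, chiMat A.1 i j = M.χ i j) ∨ (∀ i j, chiMat A.1 i j = - M.χ i j)) := by
  constructor
  · rintro ⟨B, hB, hB'⟩
    have hr : (grSetoid n).r A B := Quotient.exact hB
    rcases chi_of_rel A B hr with h | h <;> rcases hB' with h' | h' <;> simp [h, h']
  · intro h; exact ⟨A, rfl, h⟩

lemma le_of_mk {n : ℕ} (M N : Chirotope2 n) (A : {A : Matrix (Fin 2) (Fin n) ℝ // A.rank = 2})
    (hle : omLe N M) (hx : Quotient.mk (grSetoid n) A ∈ muFiber N) :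
    (∀ i j, chiMat A.1 i j = 0 ∨ chiMat A.1 i j = M.χ i j) ∨
    (∀ i j, chiMat A.1 i j = 0 ∨ chiMat A.1 i j = - M.χ i j) := by
  rw [muFiber_congr] at hx
  obtain ⟨ε, hε, h⟩ := hle
  rcases hε with rfl | rfl <;> rcases hx with hx | hx <;> simp only [hx]
  · left; simpa using h
  · right; intro i j; rcases h i j with h | h <;> simp [h]
  · right; simpa using h
  · left; intro i j; rcases h i j with h | h <;> simp [h]

lemma isClosed_sign {n : ℕ} (f : Fin n → Fin n → SignType) :
    IsClosed {A : {A : Matrix (Fin 2) (Fin n) ℝ // A.rank = 2} |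
      ∀ i j, chiMat A.1 i j = 0 ∨ chiMat A.1 i j = f i j} := by
  simp only [Set.ofPred_forall]
  refine isClosed_iInter fun i => isClosed_iInter fun j => ?_
  have hc : Continuous fun A : {A : Matrix (Fin 2) (Fin n) ℝ // A.rank = 2} => dt A.1 i j := by
    unfold dt
    have : ∀ r k, Continuous fun A : {A : Matrix (Fin 2) (Fin n) ℝ // A.rank = 2} => A.1 r k :=
      fun r k => continuous_subtype_val.matrix_elem r k
    exact ((this 0 i).mul (this 1 j)).sub ((this 0 j).mul (this 1 i))
  rcases hf : f i j with _ | _ | _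
  · have : {A : {A : Matrix (Fin 2) (Fin n) ℝ // A.rank = 2} |
      chiMat A.1 i j = 0 ∨ chiMat A.1 i j = SignType.zero} = {A | dt A.1 i j = 0} := by
      ext A
      simp only [Set.mem_ofPred_eq, chiMat_eq]
      rw [← sign_eq_zero_iff (a := dt A.1 i j)]; exact or_self_iff
    rw [this]; exact isClosed_eq hc continuous_const
  · have : {A : {A : Matrix (Fin 2) (Fin n) ℝ // A.rank = 2} |
      chiMat A.1 i j = 0 ∨ chiMat A.1 i j = SignType.neg} = {A | dt A.1 i j ≤ 0} := by
      ext A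
      simp only [Set.mem_ofPred_eq, chiMat_eq]
      rw [le_iff_eq_or_lt, sign_eq_zero_iff, ← sign_eq_neg_one_iff]; rfl
    rw [this]; exact isClosed_le hc continuous_const
  · have : {A : {A : Matrix (Fin 2) (Fin n) ℝ // A.rank = 2} |
      chiMat A.1 i j = 0 ∨ chiMat A.1 i j = SignType.pos} = {A | 0 ≤ dt A.1 i j} := by
      ext A
      simp only [Set.mem_ofPred_eq, chiMat_eq]
      rw [le_iff_eq_or_lt, sign_eq_zero_iff, ← sign_eq_one_iff, eq_comm (a := (0:ℝ))]; rfl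
    rw [this]; exact isClosed_le continuous_const hc

lemma closure_eq {n : ℕ} (M : Chirotope2 n) : closure (muFiber M) =
      {x : Gr2 n | ∃ N : Chirotope2 n, omLe N M ∧ x ∈ muFiber N} := by
  apply Set.Subset.antisymm
  · apply closure_minimal
    · intro x hx
      exact ⟨M, ⟨1, Or.inl rfl, fun i j => Or.inr (by simp)⟩, hx⟩
    · have hq : Topology.IsQuotientMap (Quotient.mk (grSetoid n)) := isQuotientMap_quotient_mk'
      rw [← hq.isClosed_preimage]
      convert (isClosed_sign M.χ).union (isClosed_sign (fun i j => - M.χ i j)) using 1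
      ext A
      constructor
      · rintro ⟨N, h1, h2⟩
        exact le_of_mk M N A h1 h2
      · intro h
        refine ⟨omOf A.1 A.2, ?_, (muFiber_congr _ A).2 (Or.inl fun _ _ => rfl)⟩
        rcases h with h | h
        · exact ⟨1, Or.inl rfl, by simp only [one_mul]; exact h⟩
        · exact ⟨-1, Or.inr rfl, by simp only [neg_one_mul]; exact h⟩
  · rintro x ⟨N, h1, h2⟩
    obtain ⟨A, rfl⟩ := Quotient.exists_rep x
    rcases le_of_mk M N A h1 h2 with h | h
    · refine closure_mono ?_ (mk_mem_closure M A h)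
      rintro _ ⟨B, hB, rfl⟩
      exact ⟨B, rfl, Or.inl hB⟩
    · refine closure_mono ?_ (mk_mem_closure (negOM M) A h)
      rintro _ ⟨B, hB, rfl⟩
      exact ⟨B, rfl, Or.inr hB⟩

/-- The boundary of the closure of `μ⁻¹(M)` in `Gr(2, ℝⁿ)` is the union of the fibers
`μ⁻¹(N)` over all `N < M`; equivalently, the closure of `μ⁻¹(M)` is the union of the
fibers `μ⁻¹(N)` over all `N ≤ M`. -/
theorem boundary_muFiber_eq {n : ℕ} (M : Chirotope2 n) :
    (closure (muFiber M) \ muFiber M =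
      {x : Gr2 n | ∃ N : Chirotope2 n, omLt N M ∧ x ∈ muFiber N}) ∧
    (closure (muFiber M) =
      {x : Gr2 n | ∃ N : Chirotope2 n, omLe N M ∧ x ∈ muFiber N}) := by
  refine ⟨?_, closure_eq M⟩
  rw [closure_eq M]
  ext x
  obtain ⟨A, rfl⟩ := Quotient.exists_rep x
  constructor
  · rintro ⟨⟨N, h1, h2⟩, h3⟩
    refine ⟨N, ⟨h1, fun h4 => h3 ?_⟩, h2⟩
    rw [muFiber_congr] at h2 ⊢
    obtain ⟨ε, hε, h⟩ := h1
    obtain ⟨δ, hδ, h'⟩ := h4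
    have key : ∀ i j, N.χ i j = ε * M.χ i j := by
      intro i j
      have e1 := h i j
      have e2 := h' i j
      clear h h'
      revert e1 e2
      generalize M.χ i j = a
      generalize N.χ i j = b
      rcases hε with rfl | rfl <;> rcases hδ with rfl | rfl <;> clear * - <;> revert a b <;> decide
    rcases hε with rfl | rfl <;> rcases h2 with h2 | h2 <;> simp [h2, key]
  · rintro ⟨N, ⟨h1, h2⟩, h3⟩
    refine ⟨⟨N, h1, h3⟩, fun h4 => h2 ?_⟩
    rw [muFiber_congr] at h3 h4
    rcases h3 with h3 | h3 <;> rcases h4 with h4 | h4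
    · exact ⟨1, Or.inl rfl, fun i j => Or.inr (by rw [← h3, ← h4]; simp)⟩
    · exact ⟨-1, Or.inr rfl, fun i j => Or.inr (by rw [← h3, h4]; simp)⟩
    · exact ⟨-1, Or.inr rfl, fun i j => Or.inr (by rw [← h4, h3]; simp)⟩
    · refine ⟨1, Or.inl rfl, fun i j => Or.inr ?_⟩
      have := (h4 i j).symm.trans (h3 i j)
      simpa using this
end

section
/- For every rank-2 oriented matroid M on [n], the fiber μ^{-1}(M) ⊆ Gr(2,ℝ^n) is homeomorphic to an open ball of dimension l_M + p_M - 4, where l_M is the number of non-loops of M and p_M the number of parallel/anti-parallel classes of M. -/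
/-- The number of non-loop elements of `M`. -/
noncomputable def lM {n : ℕ} (M : Chirotope2 n) : ℕ :=
  Nat.card {i : Fin n // ¬ IsLoop M i}

/-- The number of distinct parallel/anti-parallel classes of `M`. -/
noncomputable def pM {n : ℕ} (M : Chirotope2 n) : ℕ :=
  Nat.card {S : Set (Fin n) // ∃ i, ¬ IsLoop M i ∧ S = ParClass M i}

open Set in
/-- An open bounded convex nonempty set in a finite-dimensional space is a ball. -/
theorem convex_homeo_ball {E : Type*} [NormedAddCommGroup E] [NormedSpace ℝ E]
    [FiniteDimensional ℝ E] (N : ℕ) (hN : Module.finrank ℝ E = N) (s : Set E)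
    (ho : IsOpen s) (hc : Convex ℝ s) (hb : Bornology.IsBounded s) (hne : s.Nonempty) :
    Nonempty (s ≃ₜ (Metric.ball (0 : EuclideanSpace ℝ (Fin N)) 1 : Set _)) := by
  obtain ⟨h, h1, -, -⟩ := exists_homeomorph_image_interior_closure_frontier_eq_unitBall hc
    (by rwa [ho.interior_eq]) hb
  rw [ho.interior_eq] at h1
  have e1 : s ≃ₜ (Metric.ball (0 : E) 1 : Set E) :=
    (h.image s).trans (Homeomorph.setCongr h1)
  have e2 : E ≃L[ℝ] EuclideanSpace ℝ (Fin N) :=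
    ContinuousLinearEquiv.ofFinrankEq (by simp [hN])
  exact ⟨e1.trans ((Homeomorph.unitBall (E := E)).symm.trans
    (e2.toHomeomorph.trans Homeomorph.unitBall))⟩

/-- The minor of columns `i`, `j`. -/
def mnr {n : ℕ} (A : Matrix (Fin 2) (Fin n) ℝ) (i j : Fin n) : ℝ :=
  A 0 i * A 1 j - A 0 j * A 1 i

theorem mnr_mul {n : ℕ} (g : Matrix (Fin 2) (Fin 2) ℝ) (A : Matrix (Fin 2) (Fin n) ℝ)
    (i j : Fin n) : mnr (g * A) i j = (g 0 0 * g 1 1 - g 0 1 * g 1 0) * mnr A i j := by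
  simp only [mnr, Matrix.mul_apply, Fin.sum_univ_two]
  ring

/-- Normal form of a matrix with respect to columns `i0`, `j0`. -/
noncomputable def nrm {n : ℕ} (i0 j0 : Fin n) (A : Matrix (Fin 2) (Fin n) ℝ) :
    Matrix (Fin 2) (Fin n) ℝ :=
  Matrix.of ![fun k => mnr A k j0 / mnr A i0 j0, fun k => mnr A i0 k / mnr A i0 j0]

theorem range_le_iff {n : ℕ} (A B : Matrix (Fin 2) (Fin n) ℝ) :
    LinearMap.range (Matrix.vecMulLinear A) ≤ LinearMap.range (Matrix.vecMulLinear B) ↔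
      ∃ g : Matrix (Fin 2) (Fin 2) ℝ, A = g * B := by
  constructor
  · intro h
    have : ∀ r : Fin 2, ∃ v : Fin 2 → ℝ, Matrix.vecMul v B = A r := by
      intro r
      have h1 : A r ∈ LinearMap.range (Matrix.vecMulLinear A) :=
        ⟨Pi.single r 1, by simp [Matrix.row]⟩
      obtain ⟨v, hv⟩ := h h1
      exact ⟨v, by simpa using hv⟩
    choose g hg using this
    refine ⟨Matrix.of g, ?_⟩
    ext r k
    have := congrFun (hg r) k
    rw [← this]
    simp [Matrix.vecMul, dotProduct, Matrix.mul_apply]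
  · rintro ⟨g, rfl⟩ x ⟨v, rfl⟩
    exact ⟨Matrix.vecMul v g, by simp [Matrix.vecMul_vecMul]⟩

theorem nrm_congr {n : ℕ} (i0 j0 : Fin n) (A B : Matrix (Fin 2) (Fin n) ℝ)
    (h : LinearMap.range (Matrix.vecMulLinear A) = LinearMap.range (Matrix.vecMulLinear B)) :
    nrm i0 j0 A = nrm i0 j0 B := by
  obtain ⟨g, hg⟩ := (range_le_iff A B).1 h.le
  obtain ⟨g', hg'⟩ := (range_le_iff B A).1 h.ge
  have key : ∀ i j, mnr A i j / mnr A i0 j0 = mnr B i j / mnr B i0 j0 := by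
    intro i j
    have h1 : ∀ i j, mnr A i j = (g 0 0 * g 1 1 - g 0 1 * g 1 0) * mnr B i j := by
      intro i j
      conv_lhs => rw [hg]
      exact mnr_mul _ _ _ _
    have h2 : ∀ i j, mnr B i j = (g' 0 0 * g' 1 1 - g' 0 1 * g' 1 0) * mnr A i j := by
      intro i j
      conv_lhs => rw [hg']
      exact mnr_mul _ _ _ _
    by_cases hz : g 0 0 * g 1 1 - g 0 1 * g 1 0 = 0
    · have h3 : ∀ i j, mnr A i j = 0 := fun i j => by rw [h1, hz, zero_mul]
      rw [h2 i j, h3, h3]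
      simp
    · rw [h1 i j, h1 i0 j0, mul_div_mul_left _ _ hz]
  ext r k
  fin_cases r
  · exact key k j0
  · exact key i0 k

/-- The transformation to normal form. -/
theorem nrm_eq_mul {n : ℕ} (i0 j0 : Fin n) (A : Matrix (Fin 2) (Fin n) ℝ) :
    nrm i0 j0 A = !![A 1 j0 / mnr A i0 j0, - A 0 j0 / mnr A i0 j0;
      - A 1 i0 / mnr A i0 j0, A 0 i0 / mnr A i0 j0] * A := by
  ext r k
  fin_cases r
  · simp [nrm, Matrix.mul_apply, Fin.sum_univ_two]
    simp only [mnr]; ring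
  · simp [nrm, Matrix.mul_apply, Fin.sum_univ_two]
    simp only [mnr]; ring

theorem eq_mul_nrm {n : ℕ} (i0 j0 : Fin n) (A : Matrix (Fin 2) (Fin n) ℝ)
    (h : mnr A i0 j0 ≠ 0) :
    A = !![A 0 i0, A 0 j0; A 1 i0, A 1 j0] * nrm i0 j0 A := by
  ext r k
  fin_cases r
  · simp [nrm, Matrix.mul_apply, Fin.sum_univ_two]
    field_simp
    simp only [mnr]; ring
  · simp [nrm, Matrix.mul_apply, Fin.sum_univ_two]
    field_simp
    simp only [mnr]; ring

theorem mnr_nrm {n : ℕ} (i0 j0 : Fin n) (A : Matrix (Fin 2) (Fin n) ℝ)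
    (h : mnr A i0 j0 ≠ 0) (i j : Fin n) :
    mnr (nrm i0 j0 A) i j = mnr A i j / mnr A i0 j0 := by
  rw [nrm_eq_mul, mnr_mul]
  simp
  have h2 : A 1 j0 / mnr A i0 j0 * (A 0 i0 / mnr A i0 j0) - - A 0 j0 / mnr A i0 j0 * (- A 1 i0 / mnr A i0 j0)
    = 1 / mnr A i0 j0 := by
    field_simp
    simp only [mnr]; ring
  rw [h2]; ring

/-- Normalized realizations. -/
def NSet {n : ℕ} (M : Chirotope2 n) (i0 j0 : Fin n) : Set (Matrix (Fin 2) (Fin n) ℝ) :=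
  {B | B 0 i0 = 1 ∧ B 1 i0 = 0 ∧ B 0 j0 = 0 ∧ B 1 j0 = 1 ∧ ∀ i j, chiMat B i j = M.χ i j}

theorem rank_of_minor {n : ℕ} (B : Matrix (Fin 2) (Fin n) ℝ) (i j : Fin n)
    (h : mnr B i j ≠ 0) : B.rank = 2 := by
  have : LinearIndependent ℝ B.row := by
    rw [Fintype.linearIndependent_iff]
    intro g hg
    have hi := congrFun hg i
    have hj := congrFun hg j
    simp only [Fin.sum_univ_two, Matrix.row, Pi.add_apply, Pi.smul_apply, smul_eq_mul,
      Pi.zero_apply] at hi hj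
    have h0 : g 0 * mnr B i j = 0 := by
      simp only [mnr]; linear_combination B 1 j * hi - B 1 i * hj
    have h1 : g 1 * mnr B i j = 0 := by
      simp only [mnr]; linear_combination B 0 i * hj - B 0 j * hi
    intro r
    fin_cases r
    · exact (mul_eq_zero.1 h0).resolve_right h
    · exact (mul_eq_zero.1 h1).resolve_right h
  simpa using this.rank_matrix

theorem nrm_of_NSet {n : ℕ} (M : Chirotope2 n) (i0 j0 : Fin n) (B : Matrix (Fin 2) (Fin n) ℝ)
    (hB : B ∈ NSet M i0 j0) : nrm i0 j0 B = B := by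
  obtain ⟨h1, h2, h3, h4, -⟩ := hB
  ext r k
  fin_cases r <;> simp [nrm, mnr, h1, h2, h3, h4]

theorem mnr_ne_of_mem {n : ℕ} (M : Chirotope2 n) (i0 j0 : Fin n) (h : M.χ i0 j0 = 1)
    (A : Matrix (Fin 2) (Fin n) ℝ)
    (hA : (∀ i j, chiMat A i j = M.χ i j) ∨ (∀ i j, chiMat A i j = - M.χ i j)) :
    mnr A i0 j0 ≠ 0 := by
  intro h0
  have h1 : chiMat A i0 j0 = 0 := by
    rw [chiMat]; rw [mnr] at h0; rw [h0]; simp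
  rcases hA with hA | hA <;> · rw [hA, h] at h1; revert h1; decide

theorem nrm_mem {n : ℕ} (M : Chirotope2 n) (i0 j0 : Fin n) (h : M.χ i0 j0 = 1)
    (A : Matrix (Fin 2) (Fin n) ℝ)
    (hA : (∀ i j, chiMat A i j = M.χ i j) ∨ (∀ i j, chiMat A i j = - M.χ i j)) :
    nrm i0 j0 A ∈ NSet M i0 j0 := by
  have hne := mnr_ne_of_mem M i0 j0 h A hA
  refine ⟨?_, ?_, ?_, ?_, ?_⟩
  · simp [nrm, hne]
  · simp [nrm]; left; simp only [mnr]; ring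
  · simp [nrm]; left; simp only [mnr]; ring
  · simp [nrm, hne]
  · intro i j
    change SignType.sign (mnr (nrm i0 j0 A) i j) = _
    rw [mnr_nrm _ _ _ hne, div_eq_mul_inv, sign_mul]
    have e : ∀ i j, SignType.sign (mnr A i j) = chiMat A i j := fun _ _ => rfl
    rcases hA with hA | hA
    · have hp : 0 < mnr A i0 j0 := by rw [← sign_eq_one_iff, e, hA, h]
      rw [sign_pos (inv_pos.2 hp), e, hA, mul_one]
    · have hp : mnr A i0 j0 < 0 := by rw [← sign_eq_neg_one_iff, e, hA, h]
      rw [sign_neg (inv_lt_zero.2 hp), e, hA]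
      simp

/-- Normal form on the Grassmannian. -/
noncomputable def nrmQ {n : ℕ} (i0 j0 : Fin n) : Gr2 n → Matrix (Fin 2) (Fin n) ℝ :=
  Quotient.lift (fun A => nrm i0 j0 A.1) (fun A B h => nrm_congr i0 j0 A.1 B.1 h)

theorem mnr_cont {n : ℕ} (i j : Fin n) :
    Continuous (fun A : Matrix (Fin 2) (Fin n) ℝ => mnr A i j) := by
  unfold mnr; fun_prop

theorem nrmQ_contOn {n : ℕ} (M : Chirotope2 n) (i0 j0 : Fin n) (h : M.χ i0 j0 = 1) :
    ContinuousOn (nrmQ i0 j0) (muFiber M) := by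
  let U : Set (Gr2 n) := {x | nrmQ i0 j0 x 0 i0 ≠ 0}
  have hpre : (Quotient.mk (grSetoid n)) ⁻¹' U = {A | mnr A.1 i0 j0 ≠ 0} := by
    ext A
    change mnr A.1 i0 j0 / mnr A.1 i0 j0 ≠ 0 ↔ mnr A.1 i0 j0 ≠ 0
    simp
  have hU : IsOpen U := by
    rw [← isQuotientMap_quotient_mk'.isOpen_preimage]
    change IsOpen ((Quotient.mk (grSetoid n)) ⁻¹' U)
    rw [hpre]
    exact isOpen_ne_fun ((mnr_cont i0 j0).comp continuous_subtype_val) continuous_const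
  have hc : ContinuousOn (nrmQ i0 j0) U := by
    rw [(isQuotientMap_quotient_mk' (s := grSetoid n)).continuousOn_isOpen_iff hU]
    change ContinuousOn _ ((Quotient.mk (grSetoid n)) ⁻¹' U)
    rw [hpre]
    change ContinuousOn (fun A : {A : Matrix (Fin 2) (Fin n) ℝ // A.rank = 2} => nrm i0 j0 A.1) _
    refine continuousOn_pi.2 fun r => continuousOn_pi.2 fun k => ?_
    have hm : ∀ i j, ContinuousOn (fun A : {A : Matrix (Fin 2) (Fin n) ℝ // A.rank = 2} =>
      mnr A.1 i j) {A | mnr A.1 i0 j0 ≠ 0} := fun i j =>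
        ((mnr_cont i j).comp continuous_subtype_val).continuousOn
    fin_cases r
    · exact (hm k j0).div (hm i0 j0) (fun A hA => hA)
    · exact (hm i0 k).div (hm i0 j0) (fun A hA => hA)
  refine hc.mono ?_
  rintro x ⟨A, rfl, hA⟩
  have := mnr_ne_of_mem M i0 j0 h A.1 hA
  change A ∈ (Quotient.mk (grSetoid n)) ⁻¹' U
  rw [hpre]; exact this

theorem NSet_rank {n : ℕ} (M : Chirotope2 n) (i0 j0 : Fin n) (B : Matrix (Fin 2) (Fin n) ℝ)
    (hB : B ∈ NSet M i0 j0) : B.rank = 2 := by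
  obtain ⟨h1, h2, h3, h4, -⟩ := hB
  exact rank_of_minor B i0 j0 (by simp [mnr, h1, h2, h3, h4])

/-- The fiber is homeomorphic to the set of normalized realizations. -/
noncomputable def fiberHomeo {n : ℕ} (M : Chirotope2 n) (i0 j0 : Fin n) (h : M.χ i0 j0 = 1) :
    muFiber M ≃ₜ NSet M i0 j0 where
  toFun x := ⟨nrmQ i0 j0 x.1, by
    obtain ⟨x, A, rfl, hA⟩ := x
    exact nrm_mem M i0 j0 h A.1 hA⟩
  invFun B := ⟨Quotient.mk (grSetoid n) ⟨B.1, NSet_rank M i0 j0 B.1 B.2⟩,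
    ⟨_, rfl, Or.inl B.2.2.2.2.2⟩⟩
  left_inv := by
    rintro ⟨x, A, rfl, hA⟩
    apply Subtype.ext
    apply Quotient.sound
    change LinearMap.range (Matrix.vecMulLinear (nrm i0 j0 A.1)) =
      LinearMap.range (Matrix.vecMulLinear A.1)
    apply le_antisymm
    · exact (range_le_iff _ _).2 ⟨_, nrm_eq_mul i0 j0 A.1⟩
    · exact (range_le_iff _ _).2 ⟨_, eq_mul_nrm i0 j0 A.1 (mnr_ne_of_mem M i0 j0 h A.1 hA)⟩
  right_inv := by
    rintro ⟨B, hB⟩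
    exact Subtype.ext (nrm_of_NSet M i0 j0 B hB)
  continuous_toFun := by
    refine Continuous.subtype_mk ?_ _
    exact (nrmQ_contOn M i0 j0 h).domRestrict
  continuous_invFun := by
    refine Continuous.subtype_mk ?_ _
    exact continuous_quotient_mk'.comp (Continuous.subtype_mk continuous_subtype_val _)

section Comb

variable {n : ℕ} (M : Chirotope2 n)

theorem chi_self (i : Fin n) : M.χ i i = 0 := by
  have := M.alt i i
  revert this
  generalize M.χ i i = a
  revert a; decide

theorem gp_sign : ∀ a b c : SignType,
    ((a = 0 ∧ b = 0 ∧ c = 0) ∨ ((a = 1 ∨ -b = 1 ∨ c = 1) ∧ (a = -1 ∨ -b = -1 ∨ c = -1))) →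
    c = 0 → a = b := by decide

/-- Grassmann–Plücker when the third term vanishes. -/
theorem gp_zero (x y0 y1 y2 : Fin n) (h : M.χ y2 x * M.χ y0 y1 = 0) :
    M.χ y0 x * M.χ y1 y2 = M.χ y1 x * M.χ y0 y2 :=
  gp_sign _ _ _ (M.gp x y0 y1 y2) h

theorem par_of_chi_zero (k k' : Fin n) (hk : ¬ IsLoop M k) (hk' : ¬ IsLoop M k')
    (h : M.χ k k' = 0) : ParClass M k = ParClass M k' := by
  unfold IsLoop at hk hk'
  push Not at hk hk'
  obtain ⟨x, hx⟩ := hk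
  have key : ∀ y, M.χ k x * M.χ k' y = M.χ k' x * M.χ k y := fun y =>
    gp_zero M x k k' y (by rw [h, mul_zero])
  have hx' : M.χ k' x ≠ 0 := by
    intro h0
    obtain ⟨y, hy⟩ := hk'
    have := key y
    rw [h0, zero_mul, mul_eq_zero] at this
    tauto
  have aux : ∀ a b c d : SignType, a ≠ 0 → b ≠ 0 → a * c = b * d →
    (a = b ∧ c = d) ∨ (a = -b ∧ c = -d) := by decide
  have h2 : (∀ y, M.χ k y = M.χ k' y) ∨ (∀ y, M.χ k y = - M.χ k' y) := by
    by_cases hab : M.χ k x = M.χ k' x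
    · left
      intro y
      have h3 := key y
      rcases aux _ _ _ _ hx hx' h3 with h | h
      · exact h.2.symm
      · rw [hab] at h
        have : ∀ a : SignType, a = - a → a = 0 := by decide
        exact absurd (this _ h.1) hx'
    · right
      intro y
      have h3 := key y
      rcases aux _ _ _ _ hx hx' h3 with h | h
      · exact absurd h.1 hab
      · rw [h.2, neg_neg]
  have hneg : ∀ a b : SignType, a = - b ↔ - a = b := by decide
  ext j
  simp only [ParClass, Set.mem_ofPred_eq]
  rcases h2 with h2 | h2
  · simp only [h2]
  · simp only [h2, neg_neg]; tauto

theorem chi_zero_of_par (k k' : Fin n) (h : ParClass M k = ParClass M k') : M.χ k k' = 0 := by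
  have : k ∈ ParClass M k' := by rw [← h]; left; intro; rfl
  rcases this with h | h
  · rw [h, chi_self]
  · rw [h, chi_self]; rfl

theorem not_loop_left {k k' : Fin n} (h : M.χ k k' ≠ 0) : ¬ IsLoop M k := fun h' => h (h' k')

theorem not_loop_right {k k' : Fin n} (h : M.χ k k' ≠ 0) : ¬ IsLoop M k' := fun h' => h (by
  rw [M.alt, h' k]; rfl)

variable (i0 j0 : Fin n)

/-- The reoriented sign, comparing the slopes of `k`, `k'`. -/
def slp (k k' : Fin n) : SignType := M.χ k j0 * M.χ k' j0 * M.χ k k'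

theorem slp_alt (k k' : Fin n) : slp M j0 k k' = - slp M j0 k' k := by
  unfold slp
  rw [M.alt k k']
  generalize M.χ k j0 = a
  generalize M.χ k' j0 = b
  generalize M.χ k' k = c
  revert a b c; decide

theorem slp_trans (a b c : Fin n) (h1 : slp M j0 a b = 1)
    (h2 : slp M j0 b c = 1 ∨ slp M j0 b c = 0 ∧ M.χ c j0 ≠ 0) : slp M j0 a c = 1 := by
  have := M.gp j0 a b c
  revert this h1 h2
  unfold slp
  generalize M.χ a j0 = x
  generalize M.χ b j0 = y
  generalize M.χ c j0 = z
  generalize M.χ a b = u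
  generalize M.χ b c = v
  generalize M.χ a c = w
  revert x y z u v w
  decide

theorem slp_trans' (a b c : Fin n) (h1 : slp M j0 a b = 0) (ha : M.χ a j0 ≠ 0)
    (h2 : slp M j0 b c = 1) : slp M j0 a c = 1 := by
  have := M.gp j0 a b c
  revert this h1 h2 ha
  unfold slp
  generalize M.χ a j0 = x
  generalize M.χ b j0 = y
  generalize M.χ c j0 = z
  generalize M.χ a b = u
  generalize M.χ b c = v
  generalize M.χ a c = w
  revert x y z u v w
  decide

theorem exists_slopes : ∃ f : Fin n → ℝ, f i0 = 0 ∧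
    ∀ k k', M.χ k j0 ≠ 0 → M.χ k' j0 ≠ 0 → SignType.sign (f k' - f k) = slp M j0 k k' := by
  classical
  let D : Fin n → Finset (Fin n) := fun k => Finset.univ.filter fun x => slp M j0 x k = 1
  have hlt : ∀ k k', slp M j0 k k' = 1 → (D k).card < (D k').card := by
    intro k k' h
    apply Finset.card_lt_card
    rw [Finset.ssubset_iff_of_subset]
    · refine ⟨k, by simp [D, h], ?_⟩
      simp only [D, Finset.mem_filter, Finset.mem_univ, true_and]
      intro h'
      rw [slp, chi_self, mul_zero] at h'
      revert h'; decide
    · intro x hx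
      simp only [D, Finset.mem_filter, Finset.mem_univ, true_and] at hx ⊢
      exact slp_trans M j0 _ _ _ hx (Or.inl h)
  have heq : ∀ k k', M.χ k j0 ≠ 0 → M.χ k' j0 ≠ 0 → slp M j0 k k' = 0 → D k = D k' := by
    intro k k' hk hk' h
    ext x
    simp only [D, Finset.mem_filter, Finset.mem_univ, true_and]
    constructor
    · intro hx
      exact slp_trans M j0 _ _ _ hx (Or.inr ⟨h, hk'⟩)
    · intro hx
      refine slp_trans M j0 _ _ _ hx (Or.inr ⟨?_, hk⟩)
      rw [slp_alt, h]; rfl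
  refine ⟨fun k => ((D k).card : ℝ) - (D i0).card, by simp, ?_⟩
  intro k k' hk hk'
  rcases h : slp M j0 k k' with _ | _ | _
  · have := heq k k' hk hk' h
    simp [this]
  · have h' : slp M j0 k' k = 1 := by rw [slp_alt, h]; rfl
    have := hlt _ _ h'
    have h3 : ((D k').card : ℝ) < (D k).card := by exact_mod_cast this
    rw [sign_neg (by linarith)]; rfl
  · have := hlt _ _ h
    have h3 : ((D k).card : ℝ) < (D k').card := by exact_mod_cast this
    rw [sign_pos (by linarith)]; rfl

theorem chi_vert (h : M.χ i0 j0 = 1) (k k' : Fin n) (hk : M.χ k j0 = 0) :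
    M.χ k k' = - (M.χ k' j0 * M.χ i0 k) := by
  have := M.gp j0 i0 k k'
  revert this
  rw [h, hk]
  generalize M.χ k' j0 = x
  generalize M.χ k k' = y
  generalize M.χ i0 k = z
  generalize M.χ i0 k' = w
  revert x y z w
  decide

/-- The matrix with prescribed radii and slopes. -/
noncomputable def mkMat (ρ m : Fin n → ℝ) : Matrix (Fin 2) (Fin n) ℝ :=
  Matrix.of ![fun k => (M.χ k j0 : ℝ) * ρ k,
    fun k => if M.χ k j0 = 0 then (M.χ i0 k : ℝ) * ρ k else (M.χ k j0 : ℝ) * ρ k * m k]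

theorem sign_cast (s : SignType) : SignType.sign (s : ℝ) = s := by
  rcases s with _ | _ | _ <;> simp

theorem mkMat_mem (h : M.χ i0 j0 = 1) (ρ m : Fin n → ℝ) (hρ : ∀ k, 0 < ρ k)
    (hi : ρ i0 = 1) (hj : ρ j0 = 1) (hm : m i0 = 0)
    (hs : ∀ k k', M.χ k j0 ≠ 0 → M.χ k' j0 ≠ 0 → SignType.sign (m k' - m k) = slp M j0 k k') :
    mkMat M i0 j0 ρ m ∈ NSet M i0 j0 := by
  refine ⟨?_, ?_, ?_, ?_, ?_⟩
  · simp [mkMat, h, hi]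
  · simp [mkMat, h, hm]
  · simp [mkMat, chi_self]
  · simp [mkMat, chi_self, h, hj]
  · intro k k'
    by_cases hk : M.χ k j0 = 0
    · have e : chiMat (mkMat M i0 j0 ρ m) k k' =
          SignType.sign (-((M.χ k' j0 : ℝ) * ρ k' * ((M.χ i0 k : ℝ) * ρ k))) := by
        simp [chiMat, mkMat, hk]
      rw [e, chi_vert M i0 j0 h k k' hk, Left.sign_neg, sign_mul, sign_mul, sign_mul, sign_cast,
        sign_cast, sign_pos (hρ k), sign_pos (hρ k'), mul_one, mul_one]
    by_cases hk' : M.χ k' j0 = 0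
    · have e : chiMat (mkMat M i0 j0 ρ m) k k' =
          SignType.sign (((M.χ k j0 : ℝ) * ρ k * ((M.χ i0 k' : ℝ) * ρ k'))) := by
        simp [chiMat, mkMat, hk']
      rw [e, M.alt k k', chi_vert M i0 j0 h k' k hk', sign_mul, sign_mul, sign_mul, sign_cast,
        sign_cast, sign_pos (hρ k), sign_pos (hρ k'), mul_one, mul_one, neg_neg]
    · have e : chiMat (mkMat M i0 j0 ρ m) k k' =
          SignType.sign ((M.χ k j0 : ℝ) * ρ k * ((M.χ k' j0 : ℝ) * ρ k') * (m k' - m k)) := by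
        simp only [chiMat, mkMat, hk, hk', Matrix.of_apply, Matrix.cons_val_zero,
          Matrix.cons_val_one, if_false]
        congr 1; ring
      rw [e, sign_mul, sign_mul, sign_mul, sign_mul, sign_cast,
        sign_cast, sign_pos (hρ k), sign_pos (hρ k'), mul_one, mul_one, hs k k' hk hk', slp]
      revert hk hk'
      generalize M.χ k j0 = x
      generalize M.χ k' j0 = y
      generalize M.χ k k' = z
      revert x y z; decide

theorem NSet_sign0 {B : Matrix (Fin 2) (Fin n) ℝ} (hB : B ∈ NSet M i0 j0)
    (k : Fin n) : SignType.sign (B 0 k) = M.χ k j0 := by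
  obtain ⟨h1, h2, h3, h4, h5⟩ := hB
  rw [← h5]; simp [chiMat, h3, h4]

theorem NSet_sign1 {B : Matrix (Fin 2) (Fin n) ℝ} (hB : B ∈ NSet M i0 j0)
    (k : Fin n) : SignType.sign (B 1 k) = M.χ i0 k := by
  obtain ⟨h1, h2, h3, h4, h5⟩ := hB
  rw [← h5]; simp [chiMat, h1, h2]

theorem NSet_slope {B : Matrix (Fin 2) (Fin n) ℝ} (hB : B ∈ NSet M i0 j0)
    (k k' : Fin n) (hk : M.χ k j0 ≠ 0) (hk' : M.χ k' j0 ≠ 0) :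
    SignType.sign (B 1 k' / B 0 k' - B 1 k / B 0 k) = slp M j0 k k' := by
  have a := NSet_sign0 M i0 j0 hB k
  have a' := NSet_sign0 M i0 j0 hB k'
  have b : B 0 k ≠ 0 := by rw [← sign_ne_zero, a]; exact hk
  have b' : B 0 k' ≠ 0 := by rw [← sign_ne_zero, a']; exact hk'
  have e : SignType.sign (B 0 k * B 0 k' * (B 1 k' / B 0 k' - B 1 k / B 0 k)) = M.χ k k' := by
    rw [← hB.2.2.2.2, chiMat]; congr 1; field_simp
  rw [sign_mul, sign_mul, a, a'] at e
  rw [slp, ← e]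
  revert hk hk'
  generalize M.χ k j0 = x
  generalize M.χ k' j0 = y
  generalize SignType.sign (B 1 k' / B 0 k' - B 1 k / B 0 k) = z
  revert x y z; decide

end Comb

theorem card_remove_two {α : Type*} [Finite α] (p : α → Prop) (a b : α) (ha : p a) (hb : p b)
    (hab : a ≠ b) : Nat.card {x // p x ∧ x ≠ a ∧ x ≠ b} + 2 = Nat.card {x // p x} := by
  have h1 : Nat.card {x // p x ∧ x ≠ a ∧ x ≠ b} = ({x | p x} \ {a, b} : Set α).ncard := by
    rw [← Nat.card_coe_set_eq]
    refine Nat.card_congr (Equiv.subtypeEquivRight fun x => ?_)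
    simp
  have h2 : Nat.card {x // p x} = ({x | p x} : Set α).ncard := (Nat.card_coe_set_eq _)
  have h3 : ({a, b} : Set α).ncard = 2 := Set.ncard_pair hab
  rw [h1, h2, ← h3]
  refine Set.ncard_sdiff_add_ncard_of_subset ?_ (Set.toFinite _)
  rintro x (rfl | rfl)
  · exact ha
  · exact hb

section Param

variable {n : ℕ} (M : Chirotope2 n) (i0 j0 : Fin n)

/-- Non-loops other than the two basis elements. -/
abbrev IdxI : Type := {k : Fin n // ¬ IsLoop M k ∧ k ≠ i0 ∧ k ≠ j0}

/-- Classes other than those of the two basis elements. -/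
abbrev IdxC : Type := {S : Set (Fin n) // (∃ i, ¬ IsLoop M i ∧ S = ParClass M i) ∧
  S ≠ ParClass M i0 ∧ S ≠ ParClass M j0}

open Classical in
/-- Extend an angle function on classes to all elements. -/
noncomputable def extd (s : IdxC M i0 j0 → ℝ) (k : Fin n) : ℝ :=
  if h : (∃ i, ¬ IsLoop M i ∧ ParClass M k = ParClass M i) ∧
    ParClass M k ≠ ParClass M i0 ∧ ParClass M k ≠ ParClass M j0 then s ⟨ParClass M k, h⟩ else 0

open Classical in
/-- Radii from the parameters. -/
noncomputable def rad (t : IdxI M i0 j0 → ℝ) (k : Fin n) : ℝ :=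
  if h : ¬ IsLoop M k ∧ k ≠ i0 ∧ k ≠ j0 then t ⟨k, h⟩ / (1 - t ⟨k, h⟩) else 1

/-- The parameter space. -/
def TSet : Set ((IdxI M i0 j0 → ℝ) × (IdxC M i0 j0 → ℝ)) :=
  {x | (∀ k, x.1 k ∈ Set.Ioo (0 : ℝ) 1) ∧
    (∀ c, x.2 c ∈ Set.Ioo (-(Real.pi / 2)) (Real.pi / 2)) ∧
    ∀ k k', slp M j0 k k' = 1 → extd M i0 j0 x.2 k < extd M i0 j0 x.2 k'}

theorem ext_cont (k : Fin n) : Continuous (fun s : IdxC M i0 j0 → ℝ => extd M i0 j0 s k) := by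
  unfold extd
  split_ifs <;> fun_prop

theorem ext_lin (a b : ℝ) (s s' : IdxC M i0 j0 → ℝ) (k : Fin n) :
    extd M i0 j0 (a • s + b • s') k = a * extd M i0 j0 s k + b * extd M i0 j0 s' k := by
  unfold extd
  split_ifs <;> simp

theorem TSet_open : IsOpen (TSet M i0 j0) := by
  have : TSet M i0 j0 = (⋂ k, {x | x.1 k ∈ Set.Ioo (0 : ℝ) 1}) ∩
      ((⋂ c, {x | x.2 c ∈ Set.Ioo (-(Real.pi / 2)) (Real.pi / 2)}) ∩
      ⋂ k, ⋂ k', ⋂ (_ : slp M j0 k k' = 1),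
        {x | extd M i0 j0 x.2 k < extd M i0 j0 x.2 k'}) := by
    ext x; simp [TSet]
  rw [this]
  refine IsOpen.inter ?_ (IsOpen.inter ?_ ?_)
  · exact isOpen_iInter_of_finite fun k => isOpen_Ioo.preimage (by fun_prop)
  · exact isOpen_iInter_of_finite fun k => isOpen_Ioo.preimage (by fun_prop)
  · exact isOpen_iInter_of_finite fun k => isOpen_iInter_of_finite fun k' =>
      isOpen_iInter_of_finite fun _ => isOpen_lt ((ext_cont M i0 j0 k).comp continuous_snd)
        ((ext_cont M i0 j0 k').comp continuous_snd)

theorem TSet_convex : Convex ℝ (TSet M i0 j0) := by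
  rintro ⟨t, s⟩ ⟨h1, h2, h3⟩ ⟨t', s'⟩ ⟨h1', h2', h3'⟩ a b ha hb hab
  refine ⟨fun k => ?_, fun c => ?_, fun k k' h => ?_⟩
  · exact convex_Ioo (0 : ℝ) 1 (h1 k) (h1' k) ha hb hab
  · exact convex_Ioo _ _ (h2 c) (h2' c) ha hb hab
  · change extd M i0 j0 (a • s + b • s') k < extd M i0 j0 (a • s + b • s') k'
    rw [ext_lin, ext_lin]
    have e := h3 k k' h
    have e' := h3' k k' h
    simp only at e e'
    rcases ha.eq_or_lt with rfl | ha
    · have : b = 1 := by linarith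
      subst this; simpa using e'
    · have := mul_lt_mul_of_pos_left e ha
      have := mul_le_mul_of_nonneg_left e'.le hb
      linarith

theorem TSet_bounded : Bornology.IsBounded (TSet M i0 j0) := by
  refine Bornology.IsBounded.subset
    (t := (Set.pi Set.univ fun _ => Set.Icc (0 : ℝ) 1) ×ˢ
      (Set.pi Set.univ fun _ => Set.Icc (-(Real.pi / 2)) (Real.pi / 2))) ?_ ?_
  · exact (Bornology.IsBounded.pi fun _ => Metric.isBounded_Icc _ _).prod
      (Bornology.IsBounded.pi fun _ => Metric.isBounded_Icc _ _)
  · rintro ⟨t, s⟩ ⟨h1, h2, -⟩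
    exact ⟨fun k _ => Set.Ioo_subset_Icc_self (h1 k), fun k _ => Set.Ioo_subset_Icc_self (h2 k)⟩

open Classical in
theorem ext_par (s : IdxC M i0 j0 → ℝ) {k k' : Fin n} (h : ParClass M k = ParClass M k') :
    extd M i0 j0 s k = extd M i0 j0 s k' := by
  have key : ∀ S : Set (Fin n), S = ParClass M k' →
      (if h : (∃ i, ¬ IsLoop M i ∧ S = ParClass M i) ∧
        S ≠ ParClass M i0 ∧ S ≠ ParClass M j0 then s ⟨S, h⟩ else 0) = extd M i0 j0 s k' := by
    rintro _ rfl
    rfl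
  exact key _ h

theorem ext_i0 (s : IdxC M i0 j0 → ℝ) : extd M i0 j0 s i0 = 0 := by
  unfold extd
  rw [dif_neg]; tauto

theorem ext_mem (s : IdxC M i0 j0 → ℝ)
    (hs : ∀ c, s c ∈ Set.Ioo (-(Real.pi / 2)) (Real.pi / 2)) (k : Fin n) :
    extd M i0 j0 s k ∈ Set.Ioo (-(Real.pi / 2)) (Real.pi / 2) := by
  unfold extd
  split_ifs
  · exact hs _
  · have := Real.pi_pos
    constructor <;> linarith

theorem rad_pos (t : IdxI M i0 j0 → ℝ) (ht : ∀ k, t k ∈ Set.Ioo (0 : ℝ) 1) (k : Fin n) :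
    0 < rad M i0 j0 t k := by
  unfold rad
  split_ifs with h
  · have := ht ⟨k, h⟩
    exact div_pos this.1 (by linarith [this.2])
  · exact one_pos

/-- From parameters to matrices. -/
noncomputable def fromT (x : (IdxI M i0 j0 → ℝ) × (IdxC M i0 j0 → ℝ)) :
    Matrix (Fin 2) (Fin n) ℝ :=
  mkMat M i0 j0 (rad M i0 j0 x.1) (fun k => Real.tan (extd M i0 j0 x.2 k))

theorem chi_zero_of_slp {k k' : Fin n} (hk : M.χ k j0 ≠ 0) (hk' : M.χ k' j0 ≠ 0)
    (h : slp M j0 k k' = 0) : M.χ k k' = 0 := by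
  rw [slp, mul_eq_zero, mul_eq_zero] at h
  tauto

theorem fromT_mem (h : M.χ i0 j0 = 1) (x) (hx : x ∈ TSet M i0 j0) :
    fromT M i0 j0 x ∈ NSet M i0 j0 := by
  obtain ⟨h1, h2, h3⟩ := hx
  refine mkMat_mem M i0 j0 h _ _ (rad_pos M i0 j0 _ h1) (by simp [rad]) (by simp [rad])
    (by simp [ext_i0]) ?_
  intro k k' hk hk'
  have hlt : ∀ k k', slp M j0 k k' = 1 →
      Real.tan (extd M i0 j0 x.2 k) < Real.tan (extd M i0 j0 x.2 k') := fun k k' h =>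
    Real.strictMonoOn_tan (ext_mem M i0 j0 _ h2 k) (ext_mem M i0 j0 _ h2 k') (h3 k k' h)
  rcases e : slp M j0 k k' with _ | _ | _
  · have := par_of_chi_zero M k k' (not_loop_left M hk) (not_loop_left M hk')
      (chi_zero_of_slp M j0 hk hk' e)
    rw [ext_par M i0 j0 x.2 this]; simp
  · have h' : slp M j0 k' k = 1 := by rw [slp_alt, e]; rfl
    rw [sign_neg (by linarith [hlt _ _ h'])]; rfl
  · rw [sign_pos (by linarith [hlt _ _ e])]; rfl

/-- Representative of a class. -/
noncomputable def rep (c : IdxC M i0 j0) : Fin n := c.2.1.choose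

theorem rep_loop (c : IdxC M i0 j0) : ¬ IsLoop M (rep M i0 j0 c) := c.2.1.choose_spec.1

theorem rep_par (c : IdxC M i0 j0) : ParClass M (rep M i0 j0 c) = c.1 :=
  c.2.1.choose_spec.2.symm

theorem rep_chi (h : M.χ i0 j0 = 1) (c : IdxC M i0 j0) : M.χ (rep M i0 j0 c) j0 ≠ 0 := by
  intro h0
  have hj : ¬ IsLoop M j0 := not_loop_right M (k := i0) (by rw [h]; decide)
  have := par_of_chi_zero M _ _ (rep_loop M i0 j0 c) hj h0
  rw [rep_par] at this
  exact c.2.2.2 this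

theorem ext_rep (s : IdxC M i0 j0 → ℝ) (c : IdxC M i0 j0) :
    extd M i0 j0 s (rep M i0 j0 c) = s c := by
  unfold extd
  have hp := rep_par M i0 j0 c
  rw [dif_pos (by rw [hp]; exact c.2)]
  congr 1
  exact Subtype.ext hp

open Classical in
/-- The entry giving the radius. -/
noncomputable def ent (B : Matrix (Fin 2) (Fin n) ℝ) (k : Fin n) : ℝ :=
  if M.χ k j0 = 0 then B 1 k else B 0 k

/-- From matrices to parameters. -/
noncomputable def toT (B : Matrix (Fin 2) (Fin n) ℝ) :
    (IdxI M i0 j0 → ℝ) × (IdxC M i0 j0 → ℝ) :=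
  (fun k => |ent M j0 B k.1| / (1 + |ent M j0 B k.1|),
    fun c => Real.arctan (B 1 (rep M i0 j0 c) / B 0 (rep M i0 j0 c)))

theorem slope_eq {B : Matrix (Fin 2) (Fin n) ℝ} (hB : B ∈ NSet M i0 j0)
    {k k' : Fin n} (hk : M.χ k j0 ≠ 0) (hk' : M.χ k' j0 ≠ 0)
    (hp : ParClass M k = ParClass M k') : B 1 k / B 0 k = B 1 k' / B 0 k' := by
  have := NSet_slope M i0 j0 hB k k' hk hk'
  rw [slp, chi_zero_of_par M k k' hp, mul_zero, sign_eq_zero_iff] at this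
  linarith

theorem ext_toT (h : M.χ i0 j0 = 1) {B : Matrix (Fin 2) (Fin n) ℝ} (hB : B ∈ NSet M i0 j0)
    {k : Fin n} (hk : M.χ k j0 ≠ 0) :
    extd M i0 j0 (toT M i0 j0 B).2 k = Real.arctan (B 1 k / B 0 k) := by
  by_cases hc : ParClass M k = ParClass M i0
  · rw [ext_par M i0 j0 _ hc, ext_i0, slope_eq M i0 j0 hB hk (by rw [h]; decide) hc, hB.2.1]
    simp
  · have hj : ParClass M k ≠ ParClass M j0 := fun e => hk (chi_zero_of_par M _ _ e)
    let c : IdxC M i0 j0 := ⟨ParClass M k, ⟨k, not_loop_left M hk, rfl⟩, hc, hj⟩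
    have hp : ParClass M k = ParClass M (rep M i0 j0 c) := (rep_par M i0 j0 c).symm
    rw [ext_par M i0 j0 _ hp, ext_rep, slope_eq M i0 j0 hB hk (rep_chi M i0 j0 h c) hp]
    rfl

theorem ent_ne (h : M.χ i0 j0 = 1) {B : Matrix (Fin 2) (Fin n) ℝ} (hB : B ∈ NSet M i0 j0)
    {k : Fin n} (hk : ¬ IsLoop M k) : ent M j0 B k ≠ 0 := by
  unfold ent
  split_ifs with h0
  · rw [← sign_ne_zero, NSet_sign1 M i0 j0 hB]
    intro h1
    apply hk
    intro k'
    rw [chi_vert M i0 j0 h k k' h0, h1, mul_zero]; rfl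
  · rw [← sign_ne_zero, NSet_sign0 M i0 j0 hB]
    exact h0

theorem toT_mem (h : M.χ i0 j0 = 1) {B : Matrix (Fin 2) (Fin n) ℝ} (hB : B ∈ NSet M i0 j0) :
    toT M i0 j0 B ∈ TSet M i0 j0 := by
  refine ⟨fun k => ?_, fun c => ?_, fun k k' hs => ?_⟩
  · have := abs_pos.2 (ent_ne M i0 j0 h hB k.2.1)
    constructor
    · exact div_pos this (by linarith)
    · change |ent M j0 B k.1| / (1 + |ent M j0 B k.1|) < 1
      rw [div_lt_one (by linarith)]; linarith
  · exact Real.arctan_mem_Ioo _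
  · have hk : M.χ k j0 ≠ 0 := by
      intro h0; rw [slp, h0, zero_mul, zero_mul] at hs; revert hs; decide
    have hk' : M.χ k' j0 ≠ 0 := by
      intro h0; rw [slp, h0, mul_zero, zero_mul] at hs; revert hs; decide
    rw [ext_toT M i0 j0 h hB hk, ext_toT M i0 j0 h hB hk']
    apply Real.arctan_strictMono
    have := NSet_slope M i0 j0 hB k k' hk hk'
    rw [hs, sign_eq_one_iff] at this
    linarith

theorem rad_toT (h : M.χ i0 j0 = 1) {B : Matrix (Fin 2) (Fin n) ℝ} (hB : B ∈ NSet M i0 j0)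
    {k : Fin n} (hk : ¬ IsLoop M k) : rad M i0 j0 (toT M i0 j0 B).1 k = |ent M j0 B k| := by
  unfold rad
  split_ifs with h0
  · have := abs_pos.2 (ent_ne M i0 j0 h hB hk)
    simp only [toT]
    field_simp
    ring
  · have : k = i0 ∨ k = j0 := by tauto
    obtain ⟨h1, h2, h3, h4, -⟩ := hB
    rcases this with rfl | rfl
    · simp [ent, h, h1]
    · simp [ent, chi_self, h4]

theorem from_to (h : M.χ i0 j0 = 1) {B : Matrix (Fin 2) (Fin n) ℝ} (hB : B ∈ NSet M i0 j0) :
    fromT M i0 j0 (toT M i0 j0 B) = B := by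
  have s0 := NSet_sign0 M i0 j0 hB
  have s1 := NSet_sign1 M i0 j0 hB
  have r0 : ∀ k, fromT M i0 j0 (toT M i0 j0 B) 0 k = B 0 k := by
    intro k
    change (M.χ k j0 : ℝ) * rad M i0 j0 (toT M i0 j0 B).1 k = B 0 k
    by_cases hk : M.χ k j0 = 0
    · have := s0 k
      rw [hk, sign_eq_zero_iff] at this
      rw [hk, this]; simp
    · rw [rad_toT M i0 j0 h hB (not_loop_left M hk), ← s0, ent, if_neg hk, sign_mul_abs]
  ext r k
  fin_cases r
  · exact r0 k
  · by_cases hk : M.χ k j0 = 0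
    · have e : fromT M i0 j0 (toT M i0 j0 B) 1 k =
        (M.χ i0 k : ℝ) * rad M i0 j0 (toT M i0 j0 B).1 k := by simp [fromT, mkMat, hk]
      refine e.trans ?_
      by_cases hi : M.χ i0 k = 0
      · have := s1 k
        rw [hi, sign_eq_zero_iff] at this
        change _ = B 1 k
        rw [hi, this]; simp
      · rw [rad_toT M i0 j0 h hB (not_loop_right M hi), ← s1, ent, if_pos hk, sign_mul_abs]
        rfl
    · have e : fromT M i0 j0 (toT M i0 j0 B) 1 k = fromT M i0 j0 (toT M i0 j0 B) 0 k *
        Real.tan (extd M i0 j0 (toT M i0 j0 B).2 k) := by simp [fromT, mkMat, hk]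
      refine e.trans ?_
      have b : B 0 k ≠ 0 := by rw [← sign_ne_zero, s0]; exact hk
      rw [r0, ext_toT M i0 j0 h hB hk, Real.tan_arctan]
      change _ = B 1 k
      field_simp

theorem abs_cast_sign (s : SignType) (hs : s ≠ 0) : |(s : ℝ)| = 1 := by
  rcases s with _ | _ | _ <;> simp at hs ⊢

theorem to_from (h : M.χ i0 j0 = 1) (x) (hx : x ∈ TSet M i0 j0) :
    toT M i0 j0 (fromT M i0 j0 x) = x := by
  have hm := fromT_mem M i0 j0 h x hx
  obtain ⟨h1, h2, h3⟩ := hx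
  refine Prod.ext (funext fun k => ?_) (funext fun c => ?_)
  · have hr := rad_pos M i0 j0 _ h1 k.1
    have hw : |ent M j0 (fromT M i0 j0 x) k.1| = rad M i0 j0 x.1 k.1 := by
      have hne := ent_ne M i0 j0 h hm k.2.1
      revert hne
      unfold ent
      split_ifs with hk
      · have e : fromT M i0 j0 x 1 k.1 = (M.χ i0 k.1 : ℝ) * rad M i0 j0 x.1 k.1 := by
          simp [fromT, mkMat, hk]
        rw [e]
        intro hne
        rw [abs_mul, abs_cast_sign, one_mul, abs_of_pos hr]
        intro h0; apply hne; rw [h0]; simp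
      · have e : fromT M i0 j0 x 0 k.1 = (M.χ k.1 j0 : ℝ) * rad M i0 j0 x.1 k.1 := by
          simp [fromT, mkMat]
        rw [e]
        intro hne
        rw [abs_mul, abs_cast_sign _ hk, one_mul, abs_of_pos hr]
    change |ent M j0 (fromT M i0 j0 x) k.1| / (1 + |ent M j0 (fromT M i0 j0 x) k.1|) = _
    rw [hw]
    have ht := h1 k
    have e : rad M i0 j0 x.1 k.1 = x.1 k / (1 - x.1 k) := by
      unfold rad; rw [dif_pos k.2]
    have : 1 - x.1 k ≠ 0 := by linarith [ht.2]
    rw [e]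
    field_simp
    ring
  · have hk := rep_chi M i0 j0 h c
    have b : fromT M i0 j0 x 0 (rep M i0 j0 c) ≠ 0 := by
      rw [← sign_ne_zero, NSet_sign0 M i0 j0 hm]; exact hk
    have e : fromT M i0 j0 x 1 (rep M i0 j0 c) = fromT M i0 j0 x 0 (rep M i0 j0 c) *
        Real.tan (extd M i0 j0 x.2 (rep M i0 j0 c)) := by simp [fromT, mkMat, hk]
    have hc := h2 c
    change Real.arctan (_ / _) = _
    rw [e, mul_div_cancel_left₀ _ b, ext_rep, Real.arctan_tan hc.1 hc.2]

theorem ent_cont (k : Fin n) :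
    Continuous (fun B : Matrix (Fin 2) (Fin n) ℝ => ent M j0 B k) := by
  unfold ent; split_ifs <;> fun_prop

theorem toT_cont (h : M.χ i0 j0 = 1) : ContinuousOn (toT M i0 j0) (NSet M i0 j0) := by
  refine ContinuousOn.prodMk (continuousOn_pi.2 fun k => ?_) (continuousOn_pi.2 fun c => ?_)
  · have := (ent_cont M j0 k.1).abs
    exact (this.div (continuous_const.add this) (fun B => by
      have := abs_nonneg (ent M j0 B k.1)
      change 1 + |ent M j0 B k.1| ≠ 0
      exact ne_of_gt (by linarith))).continuousOn
  · refine Real.continuous_arctan.comp_continuousOn (ContinuousOn.div ?_ ?_ ?_)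
    · exact Continuous.continuousOn (by fun_prop)
    · exact Continuous.continuousOn (by fun_prop)
    · intro B hB
      rw [← sign_ne_zero, NSet_sign0 M i0 j0 hB]
      exact rep_chi M i0 j0 h c

theorem fromT_cont : ContinuousOn (fromT M i0 j0) (TSet M i0 j0) := by
  have hr : ∀ k, ContinuousOn (fun x : (IdxI M i0 j0 → ℝ) × (IdxC M i0 j0 → ℝ) =>
      rad M i0 j0 x.1 k) (TSet M i0 j0) := by
    intro k
    unfold rad
    split_ifs with h
    · refine ContinuousOn.div ?_ ?_ ?_
      · exact Continuous.continuousOn (by fun_prop)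
      · exact Continuous.continuousOn (by fun_prop)
      · intro x hx
        linarith [(hx.1 ⟨k, h⟩).2]
    · exact continuousOn_const
  have ht : ∀ k, ContinuousOn (fun x : (IdxI M i0 j0 → ℝ) × (IdxC M i0 j0 → ℝ) =>
      Real.tan (extd M i0 j0 x.2 k)) (TSet M i0 j0) := by
    intro k
    refine Real.continuousOn_tan_Ioo.comp
      ((ext_cont M i0 j0 k).comp continuous_snd).continuousOn ?_
    intro x hx
    exact ext_mem M i0 j0 x.2 hx.2.1 k
  refine continuousOn_pi.2 fun r => continuousOn_pi.2 fun k => ?_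
  fin_cases r
  · exact continuousOn_const.mul (hr k)
  · change ContinuousOn (fun x : (IdxI M i0 j0 → ℝ) × (IdxC M i0 j0 → ℝ) =>
      if M.χ k j0 = 0 then (M.χ i0 k : ℝ) * rad M i0 j0 x.1 k else
        (M.χ k j0 : ℝ) * rad M i0 j0 x.1 k * Real.tan (extd M i0 j0 x.2 k)) _
    split_ifs
    · exact continuousOn_const.mul (hr k)
    · exact (continuousOn_const.mul (hr k)).mul (ht k)

/-- Normalized realizations are homeomorphic to the parameter space. -/
noncomputable def paramHomeo (h : M.χ i0 j0 = 1) : NSet M i0 j0 ≃ₜ TSet M i0 j0 where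
  toFun B := ⟨toT M i0 j0 B.1, toT_mem M i0 j0 h B.2⟩
  invFun x := ⟨fromT M i0 j0 x.1, fromT_mem M i0 j0 h x.1 x.2⟩
  left_inv B := Subtype.ext (from_to M i0 j0 h B.2)
  right_inv x := Subtype.ext (to_from M i0 j0 h x.1 x.2)
  continuous_toFun := Continuous.subtype_mk (toT_cont M i0 j0 h).domRestrict _
  continuous_invFun := Continuous.subtype_mk (fromT_cont M i0 j0).domRestrict _

theorem TSet_nonempty (h : M.χ i0 j0 = 1) : (TSet M i0 j0).Nonempty := by
  obtain ⟨f, h0, hf⟩ := exists_slopes M i0 j0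
  exact ⟨_, toT_mem M i0 j0 h (mkMat_mem M i0 j0 h (fun _ => 1) f (fun _ => one_pos) rfl rfl h0 hf)⟩

theorem param_dim (h : M.χ i0 j0 = 1) :
    Module.finrank ℝ ((IdxI M i0 j0 → ℝ) × (IdxC M i0 j0 → ℝ)) = lM M + pM M - 4 := by
  classical
  have hne : M.χ i0 j0 ≠ 0 := by rw [h]; decide
  have hi := not_loop_left M hne
  have hj := not_loop_right M hne
  have hpar : ParClass M i0 ≠ ParClass M j0 := fun e => hne (chi_zero_of_par M _ _ e)
  have hij : i0 ≠ j0 := fun e => hpar (by rw [e])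
  have h1 := card_remove_two (fun k => ¬ IsLoop M k) i0 j0 hi hj hij
  have h2 := card_remove_two (fun S : Set (Fin n) => ∃ i, ¬ IsLoop M i ∧ S = ParClass M i)
    (ParClass M i0) (ParClass M j0) ⟨i0, hi, rfl⟩ ⟨j0, hj, rfl⟩ hpar
  have : Fintype (IdxI M i0 j0) := Fintype.ofFinite _
  have : Fintype (IdxC M i0 j0) := Fintype.ofFinite _
  rw [Module.finrank_prod, Module.finrank_fintype_fun_eq_card, Module.finrank_fintype_fun_eq_card,
    ← Nat.card_eq_fintype_card, ← Nat.card_eq_fintype_card]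
  change Nat.card (IdxI M i0 j0) + 2 = lM M at h1
  change Nat.card (IdxC M i0 j0) + 2 = pM M at h2
  omega

end Param

/-- For every rank-2 oriented matroid `M` on `n` elements, the fiber `μ⁻¹(M) ⊆ Gr(2, ℝⁿ)`
is homeomorphic to an open ball of dimension `l_M + p_M - 4`. -/
theorem muFiber_homeomorph_ball {n : ℕ} (M : Chirotope2 n) :
    Nonempty ((muFiber M : Set (Gr2 n)) ≃ₜ
      (Metric.ball (0 : EuclideanSpace ℝ (Fin (lM M + pM M - 4))) 1 : Set _)) := by
  have hb : ∃ i0 j0, M.χ i0 j0 = 1 := by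
    obtain ⟨i, j, hij⟩ := M.nonzero
    have h3 : ∀ a : SignType, a ≠ 0 → a = 1 ∨ -a = 1 := by decide
    rcases h3 _ hij with h | h
    · exact ⟨i, j, h⟩
    · exact ⟨j, i, by rw [M.alt]; exact h⟩
  obtain ⟨i0, j0, h⟩ := hb
  have := Fintype.ofFinite (IdxI M i0 j0)
  have := Fintype.ofFinite (IdxC M i0 j0)
  obtain ⟨e⟩ := convex_homeo_ball (lM M + pM M - 4) (param_dim M i0 j0 h) (TSet M i0 j0)
    (TSet_open M i0 j0) (TSet_convex M i0 j0) (TSet_bounded M i0 j0) (TSet_nonempty M i0 j0 h)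
  exact ⟨(fiberHomeo M i0 j0 h).trans ((paramHomeo M i0 j0 h).trans e)⟩
end
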